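/- Assume |Res F| = 1, i.e. there exist A₁,…,A_d ∈ ℂ² ∖ {(0,0)} with F₀(Z) = ∏_{i=1}^d (Z ∧ A_i) for all Z ∈ ℂ² and ∏_{i=1}^d |F₁(A_i)| = 1. In the setting of the dynatomic data below, assume moreover that n divides d_n, that F₀(1, z^{(n)}_j) ≠ 0 for all j, and that the points of formally exact period n are labeled along cycles of the map f : w ↦ F₁(1,w)/F₀(1,w): for every r ∈ {0,…,d_n/n − 1} and every k ∈ {0,…,n−2}, f(z^{(n)}_{1+nr+k}) = z^{(n)}_{1+nr+k+1}, and f(z^{(n)}_{1+nr+n−1}) = z^{(n)}_{1+nr}. Then ∏_{j=1}^{d_n} |λ^{(n)}_j − 1| = ∏_{ℓ ∣ n, ℓ < n} (∏_{j=1}^{d_ℓ} |C_{n/ℓ}(λ^{(ℓ)}_j)|)^{n/ℓ} · ∏_{r ≠ s} ∏_{k=0}^{n−1} ∏_{m=0}^{n−1} |Z^{(n)}_{1+nr+k} ∧ Z^{(n)}_{1+ns+m}|, where r, s range over {0,…,d_n/n − 1} with r ≠ s. (This expresses |Δ_{n,n}(f)|^n as the product of the absolute values of the mutual resultants of the cycle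 factors Λ^{(n)}_r of the n-th dynatomic polynomial, in the normalization |Res F| = 1; in particular the right-most product is locally bounded in families, whence Δ_{n,n} is a regular function.) -/

import Mathlib

open Filter Finset MvPolynomial

/-- Evaluation of a bivariate polynomial at a point of `ℂ²`. -/
noncomputable def ev (P : MvPolynomial (Fin 2) ℂ) (Z : ℂ × ℂ) : ℂ :=
  MvPolynomial.eval ![Z.1, Z.2] P

/-- The self-map of `ℂ²` determined by the pair `F = (F₀, F₁)`. -/
noncomputable def Fmap (F₀ F₁ : MvPolynomial (Fin 2) ℂ) (Z : ℂ × ℂ) : ℂ × ℂ :=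
  (ev F₀ Z, ev F₁ Z)

/-- The wedge `Z ∧ W = Z₀W₁ − Z₁W₀` on `ℂ²`. -/
def wedge (Z W : ℂ × ℂ) : ℂ := Z.1 * W.2 - Z.2 * W.1

/-- `d_m := ∑_{k ∣ m} μ(m/k)(d^k + 1)`, the number of periodic points of formally exact
period `m` of a degree-`d` rational map. -/
def dyndeg (d m : ℕ) : ℤ :=
  ∑ k ∈ m.divisors, ArithmeticFunction.moebius (m / k) * ((d : ℤ) ^ k + 1)

/-- The affine coordinate `z^{(m)}_j` of the point `Z^{(m)}_j = u·(1, z^{(m)}_j)`. -/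
noncomputable def zc (Zp : ℕ → ℕ → ℂ × ℂ) (m j : ℕ) : ℂ := (Zp m j).2 / (Zp m j).1

/-- The multiplier `λ^{(m)}_j`: the derivative at `z^{(m)}_j` of the map
`w ↦ F₁^{(m)}(1,w) / F₀^{(m)}(1,w)` induced by the `m`-th iterate of `F`. -/
noncomputable def lam (F₀ F₁ : MvPolynomial (Fin 2) ℂ) (Zp : ℕ → ℕ → ℂ × ℂ) (m j : ℕ) : ℂ :=
  deriv (fun w : ℂ => ((Fmap F₀ F₁)^[m] (1, w)).2 / ((Fmap F₀ F₁)^[m] (1, w)).1) (zc Zp m j)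


/-- linear form -/
noncomputable def Lf (B : ℂ × ℂ) : MvPolynomial (Fin 2) ℂ := X 0 * C B.2 - X 1 * C B.1

theorem ev_add (p q : MvPolynomial (Fin 2) ℂ) (Z) : ev (p + q) Z = ev p Z + ev q Z := by simp [ev]
theorem ev_sub (p q : MvPolynomial (Fin 2) ℂ) (Z) : ev (p - q) Z = ev p Z - ev q Z := by simp [ev]
theorem ev_mul (p q : MvPolynomial (Fin 2) ℂ) (Z) : ev (p * q) Z = ev p Z * ev q Z := by simp [ev]
theorem ev_C (c : ℂ) (Z) : ev (C c) Z = c := by simp [ev]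
theorem ev_X0 (Z) : ev (X 0) Z = Z.1 := by simp [ev]
theorem ev_X1 (Z) : ev (X 1) Z = Z.2 := by simp [ev]
theorem ev_one (Z) : ev 1 Z = 1 := by simp [ev]
theorem ev_Lf (B Z) : ev (Lf B) Z = wedge Z B := by simp [ev, Lf, wedge]
theorem ev_prod {ι : Type*} (s : Finset ι) (f : ι → MvPolynomial (Fin 2) ℂ) (Z) :
    ev (∏ i ∈ s, f i) Z = ∏ i ∈ s, ev (f i) Z := by simp [ev]
theorem ev_msprod (S : Multiset (ℂ × ℂ)) (Z) :
    ev (S.map Lf).prod Z = (S.map (fun B => wedge Z B)).prod := by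
  induction S using Multiset.induction_on with
  | empty => simp [ev_one]
  | cons a s ih => simp [ev_mul, ih, ev_Lf]

theorem ev_funext {p q : MvPolynomial (Fin 2) ℂ} (h : ∀ Z, ev p Z = ev q Z) : p = q := by
  apply MvPolynomial.funext
  intro x
  have := h (x 0, x 1)
  have e : ![x 0, x 1] = x := by ext i; fin_cases i <;> rfl
  simpa [ev, e] using this

theorem ev_comp (p W0 W1 : MvPolynomial (Fin 2) ℂ) (Z) :
    ev (aeval ![W0, W1] p) Z = ev p (ev W0 Z, ev W1 Z) := by
  unfold ev
  induction p using MvPolynomial.induction_on with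
  | C a => simp
  | add p q hp hq => rw [map_add, map_add, map_add, hp, hq]
  | mul_X p i hp => 
    rw [map_mul, map_mul, map_mul, hp, aeval_X, eval_X]
    fin_cases i <;> simp

theorem deg2 {p : MvPolynomial (Fin 2) ℂ} {D : ℕ} (hp : p.IsHomogeneous D) {m}
    (hm : m ∈ p.support) : m 0 + m 1 = D := by
  rw [hp.degree_eq_sum_deg_support hm, ← Fin.sum_univ_two (fun i => m i)]
  symm
  apply Finset.sum_subset (Finset.subset_univ _)
  intro i _ hi
  simpa using hi

theorem ev_hom {p : MvPolynomial (Fin 2) ℂ} {D : ℕ} (hp : p.IsHomogeneous D) (t : ℂ) (Z : ℂ × ℂ) :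
    ev p (t • Z) = t ^ D * ev p Z := by
  unfold ev
  rw [eval_eq', eval_eq', Finset.mul_sum]
  refine Finset.sum_congr rfl fun m hm => ?_
  have h2 : m 0 + m 1 = D := deg2 hp hm
  simp only [Fin.prod_univ_two, ← h2]
  simp
  ring

theorem wedge_smul_left (t : ℂ) (Z W) : wedge (t • Z) W = t * wedge Z W := by simp [wedge]; ring
theorem wedge_smul_right (t : ℂ) (Z W) : wedge Z (t • W) = t * wedge Z W := by simp [wedge]; ring
theorem wedge_self (Z) : wedge Z Z = 0 := by simp [wedge]; ring
theorem wedge_comm (Z W) : wedge Z W = - wedge W Z := by simp [wedge]; ring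
theorem norm_wedge_comm (Z W) : ‖wedge Z W‖ = ‖wedge W Z‖ := by rw [wedge_comm, norm_neg]

theorem wedge_eq_zero {Z W : ℂ × ℂ} (hW : W ≠ 0) (h : wedge Z W = 0) : ∃ t : ℂ, Z = t • W := by
  obtain ⟨a, b⟩ := Z
  obtain ⟨c, e⟩ := W
  simp only [wedge] at h
  by_cases hc : c = 0
  · have he : e ≠ 0 := by
      rintro rfl; exact hW (by simp [hc])
    subst hc
    refine ⟨b / e, ?_⟩
    have : a = 0 := by simpa [he] using h
    simp [this, he]
  · refine ⟨a / c, ?_⟩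
    ext
    · simp [hc]
    · simp; field_simp; linear_combination -h

/-- dehomogenization -/
noncomputable def un (p : MvPolynomial (Fin 2) ℂ) : Polynomial ℂ :=
  aeval ![(1 : Polynomial ℂ), Polynomial.X] p

theorem un_eval (p : MvPolynomial (Fin 2) ℂ) (w : ℂ) : (un p).eval w = ev p (1, w) := by
  unfold un ev
  induction p using MvPolynomial.induction_on with
  | C a => simp
  | add p q hp hq => simp [hp, hq]
  | mul_X p i hp => 
    rw [map_mul, map_mul, Polynomial.eval_mul, hp, aeval_X, eval_X]
    fin_cases i <;> simp

theorem un_natDegree {p : MvPolynomial (Fin 2) ℂ} {D : ℕ} (hp : p.IsHomogeneous D) :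
    (un p).natDegree ≤ D := by
  unfold un
  rw [MvPolynomial.aeval_def, MvPolynomial.eval₂_eq']
  refine Polynomial.natDegree_sum_le_of_forall_le _ _ fun m hm => ?_
  have h2 : m 0 + m 1 = D := deg2 hp hm
  simp only [Fin.prod_univ_two]
  simp
  refine (Polynomial.natDegree_C_mul_X_pow_le _ _).trans (by omega)

theorem hom_ext {p q : MvPolynomial (Fin 2) ℂ} {D : ℕ} (hp : p.IsHomogeneous D)
    (hq : q.IsHomogeneous D) (h : ∀ w, ev p (1, w) = ev q (1, w)) : p = q := by
  have : (X 0 : MvPolynomial (Fin 2) ℂ) * p = X 0 * q := by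
    apply ev_funext
    intro Z
    rw [ev_mul, ev_mul, ev_X0]
    by_cases hZ : Z.1 = 0
    · simp [hZ]
    · have e : Z = Z.1 • ((1 : ℂ), Z.2 / Z.1) := by ext <;> simp; field_simp
      rw [e, ev_hom hp, ev_hom hq, h]
  exact mul_left_cancel₀ (X_ne_zero _) this

theorem Lf_hom (B) : (Lf B).IsHomogeneous 1 := by
  unfold Lf
  apply IsHomogeneous.sub
  · simpa using (isHomogeneous_X ℂ (0 : Fin 2)).mul (isHomogeneous_C (Fin 2) B.2)
  · simpa using (isHomogeneous_X ℂ (1 : Fin 2)).mul (isHomogeneous_C (Fin 2) B.1)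

theorem Lfprod_hom (S : Multiset (ℂ × ℂ)) : (S.map Lf).prod.IsHomogeneous (Multiset.card S) := by
  induction S using Multiset.induction_on with
  | empty => simpa using isHomogeneous_one (Fin 2) ℂ
  | cons a s ih => 
    simp only [Multiset.map_cons, Multiset.prod_cons, Multiset.card_cons]
    rw [add_comm]; exact (Lf_hom a).mul ih

theorem Lf_ne {B : ℂ × ℂ} (hB : B ≠ 0) : Lf B ≠ 0 := by
  intro h
  apply hB
  have h1 := ev_Lf B (1, 0)
  have h2 := ev_Lf B (0, 1)
  rw [h] at h1 h2
  ext
  · simpa [ev, wedge] using h2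
  · simpa [ev, wedge] using h1.symm

theorem Lfprod_ne {S : Multiset (ℂ × ℂ)} (hS : ∀ B ∈ S, B ≠ 0) : (S.map Lf).prod ≠ 0 := by
  rw [Ne, Multiset.prod_eq_zero_iff]
  simp only [Multiset.mem_map, not_exists, not_and]
  intro B hB; exact Lf_ne (hS B hB)

theorem fac {p : MvPolynomial (Fin 2) ℂ} {D : ℕ} (hp : p.IsHomogeneous D) (h0 : p ≠ 0) :
    ∃ c : ℂ, c ≠ 0 ∧ ∃ S : Multiset (ℂ × ℂ), Multiset.card S = D ∧ (∀ B ∈ S, B ≠ 0) ∧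
      p = C c * (S.map Lf).prod := by
  have hu : un p ≠ 0 := by
    intro h
    apply h0
    apply hom_ext hp (isHomogeneous_zero _ _ _)
    intro w
    rw [← un_eval, h]; simp [ev]
  have hs := IsAlgClosed.splits (un p)
  have hcard := hs.natDegree_eq_card_roots
  have hd := un_natDegree hp
  let S : Multiset (ℂ × ℂ) := (un p).roots.map (fun r => ((-1 : ℂ), -r)) +
    Multiset.replicate (D - (un p).natDegree) ((0 : ℂ), (1 : ℂ))
  have hSc : Multiset.card S = D := by simp [S]; omega
  refine ⟨(un p).leadingCoeff, by simpa using hu, S, hSc, ?_, ?_⟩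
  · intro B hB
    simp only [S, Multiset.mem_add, Multiset.mem_map, Multiset.mem_replicate] at hB
    rcases hB with ⟨r, -, rfl⟩ | ⟨-, rfl⟩ <;> simp
  · apply hom_ext hp (D := D)
    · have := (isHomogeneous_C (Fin 2) (un p).leadingCoeff).mul (Lfprod_hom S)
      rwa [zero_add, hSc] at this
    · intro w
      rw [← un_eval, ev_mul, ev_C, ev_msprod, hs.eval_eq_prod_roots]
      simp [S, wedge]
      left
      congr 1
      apply Multiset.map_congr rfl
      intro x _; ring

theorem bez_aux {A : Type*} [CommRing A] (W0 W1 Z0 Z1 : A) (i j k l : ℕ) (h : i + j = k + l) :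
    (W0 * Z1 - W1 * Z0) ∣ (W0 ^ i * W1 ^ j) * (Z0 ^ k * Z1 ^ l) - (W0 ^ k * W1 ^ l) * (Z0 ^ i * Z1 ^ j) := by
  rcases le_total i k with hik | hik
  · obtain ⟨e, rfl⟩ := Nat.exists_eq_add_of_le hik
    obtain rfl : j = e + l := by omega
    have := sub_dvd_pow_sub_pow (W0 * Z1) (W1 * Z0) e
    obtain ⟨q, hq⟩ := this
    refine ⟨- (W0 * Z0) ^ i * (W1 * Z1) ^ l * q, ?_⟩
    linear_combination (exp := 1) (- (W0 * Z0) ^ i * (W1 * Z1) ^ l) * hq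
  · obtain ⟨e, rfl⟩ := Nat.exists_eq_add_of_le hik
    obtain rfl : l = e + j := by omega
    have := sub_dvd_pow_sub_pow (W0 * Z1) (W1 * Z0) e
    obtain ⟨q, hq⟩ := this
    refine ⟨(W0 * Z0) ^ k * (W1 * Z1) ^ j * q, ?_⟩
    linear_combination (exp := 1) ((W0 * Z0) ^ k * (W1 * Z1) ^ j) * hq

theorem bez {p q : MvPolynomial (Fin 2) ℂ} {D : ℕ} (hp : p.IsHomogeneous D) (hq : q.IsHomogeneous D)
    (W0 W1 Z0 Z1 : MvPolynomial (Fin 2) ℂ) :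
    (W0 * Z1 - W1 * Z0) ∣ aeval ![W0, W1] p * aeval ![Z0, Z1] q - aeval ![W0, W1] q * aeval ![Z0, Z1] p := by
  simp only [MvPolynomial.aeval_def, MvPolynomial.eval₂_eq', Finset.sum_mul_sum]
  rw [Finset.sum_comm (s := q.support), ← Finset.sum_sub_distrib]
  refine Finset.dvd_sum fun m hm => ?_
  rw [← Finset.sum_sub_distrib]
  refine Finset.dvd_sum fun m' hm' => ?_
  have h3 : m 0 + m 1 = m' 0 + m' 1 := by
    have a1 : m 0 + m 1 = D := deg2 hp hm
    have a2 : m' 0 + m' 1 = D := deg2 hq hm'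
    omega
  obtain ⟨r, hr⟩ := bez_aux W0 W1 Z0 Z1 _ _ _ _ h3
  refine ⟨algebraMap ℂ _ (coeff m p) * algebraMap ℂ _ (coeff m' q) * r, ?_⟩
  simp only [Fin.prod_univ_two, Matrix.cons_val_zero, Matrix.cons_val_one]
  linear_combination (algebraMap ℂ _ (coeff m p) * algebraMap ℂ _ (coeff m' q)) * hr


structure Hyp (d : ℕ) (F₀ F₁ : MvPolynomial (Fin 2) ℂ) : Prop where
  hd : 2 ≤ d
  h₀ : F₀.IsHomogeneous d
  h₁ : F₁.IsHomogeneous d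
  hcz : ∀ Z : ℂ × ℂ, ev F₀ Z = 0 → ev F₁ Z = 0 → Z = 0
  hres : ∃ S : Multiset (ℂ × ℂ), Multiset.card S = d ∧ (∀ Z, ev F₀ Z = (S.map (fun B => wedge Z B)).prod) ∧
    (S.map (fun B => ‖ev F₁ B‖)).prod = 1

/-- iterates as polynomials -/
noncomputable def Fp (F₀ F₁ : MvPolynomial (Fin 2) ℂ) : ℕ → MvPolynomial (Fin 2) ℂ × MvPolynomial (Fin 2) ℂ
  | 0 => (X 0, X 1)
  | m + 1 => (aeval ![(Fp F₀ F₁ m).1, (Fp F₀ F₁ m).2] F₀, aeval ![(Fp F₀ F₁ m).1, (Fp F₀ F₁ m).2] F₁)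

/-- period polynomial -/
noncomputable def Pp (F₀ F₁ : MvPolynomial (Fin 2) ℂ) (m : ℕ) : MvPolynomial (Fin 2) ℂ :=
  (Fp F₀ F₁ m).1 * X 1 - (Fp F₀ F₁ m).2 * X 0

theorem Fp_ev (F₀ F₁ : MvPolynomial (Fin 2) ℂ) (m : ℕ) (Z) :
    (ev (Fp F₀ F₁ m).1 Z, ev (Fp F₀ F₁ m).2 Z) = (Fmap F₀ F₁)^[m] Z := by
  induction m with
  | zero => simp [Fp, ev]
  | succ m ih =>
    rw [Function.iterate_succ_apply', ← ih]
    simp [Fp, Fmap, ev_comp, -MvPolynomial.aeval_eq_bind₁]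

theorem Fp_ev1 (F₀ F₁ : MvPolynomial (Fin 2) ℂ) (m : ℕ) (Z) :
    ev (Fp F₀ F₁ m).1 Z = ((Fmap F₀ F₁)^[m] Z).1 := by rw [← Fp_ev]
theorem Fp_ev2 (F₀ F₁ : MvPolynomial (Fin 2) ℂ) (m : ℕ) (Z) :
    ev (Fp F₀ F₁ m).2 Z = ((Fmap F₀ F₁)^[m] Z).2 := by rw [← Fp_ev]

theorem Pp_ev (F₀ F₁ : MvPolynomial (Fin 2) ℂ) (m : ℕ) (Z) :
    ev (Pp F₀ F₁ m) Z = wedge ((Fmap F₀ F₁)^[m] Z) Z := by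
  simp [Pp, ev_sub, ev_mul, ev_X0, ev_X1, Fp_ev1, Fp_ev2, wedge]

namespace Hyp
variable {d : ℕ} {F₀ F₁ : MvPolynomial (Fin 2) ℂ}

theorem Fp_hom (H : Hyp d F₀ F₁) (m : ℕ) :
    (Fp F₀ F₁ m).1.IsHomogeneous (d ^ m) ∧ (Fp F₀ F₁ m).2.IsHomogeneous (d ^ m) := by
  induction m with
  | zero => exact ⟨by simpa [Fp] using isHomogeneous_X ℂ (0 : Fin 2), by simpa [Fp] using isHomogeneous_X ℂ (1 : Fin 2)⟩
  | succ m ih =>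
    rw [pow_succ]
    have h : ∀ i, (![(Fp F₀ F₁ m).1, (Fp F₀ F₁ m).2] i).IsHomogeneous (d ^ m) := by
      intro i; fin_cases i
      · exact ih.1
      · exact ih.2
    exact ⟨H.h₀.aeval _ h, H.h₁.aeval _ h⟩

theorem Pp_hom (H : Hyp d F₀ F₁) (m : ℕ) : (Pp F₀ F₁ m).IsHomogeneous (d ^ m + 1) := by
  exact ((H.Fp_hom m).1.mul (isHomogeneous_X ℂ _)).sub ((H.Fp_hom m).2.mul (isHomogeneous_X ℂ _))

theorem it_smul (H : Hyp d F₀ F₁) (m : ℕ) (t : ℂ) (Z : ℂ × ℂ) :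
    (Fmap F₀ F₁)^[m] (t • Z) = t ^ (d ^ m) • (Fmap F₀ F₁)^[m] Z := by
  rw [← Fp_ev, ← Fp_ev, ev_hom (H.Fp_hom m).1, ev_hom (H.Fp_hom m).2]
  rfl

theorem F_smul (H : Hyp d F₀ F₁) (t : ℂ) (Z : ℂ × ℂ) :
    (Fmap F₀ F₁) (t • Z) = t ^ d • (Fmap F₀ F₁) Z := by
  simpa using H.it_smul 1 t Z

theorem F_ne (H : Hyp d F₀ F₁) {Z : ℂ × ℂ} (hZ : Z ≠ 0) : Fmap F₀ F₁ Z ≠ 0 := by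
  intro h
  simp only [Fmap, Prod.mk_eq_zero] at h
  exact hZ (H.hcz Z h.1 h.2)

theorem it_ne (H : Hyp d F₀ F₁) (m : ℕ) {Z : ℂ × ℂ} (hZ : Z ≠ 0) : (Fmap F₀ F₁)^[m] Z ≠ 0 := by
  induction m with
  | zero => simpa
  | succ m ih => rw [Function.iterate_succ_apply']; exact H.F_ne ih

theorem F_zero (H : Hyp d F₀ F₁) : Fmap F₀ F₁ 0 = 0 := by
  have := H.F_smul 0 0
  have hd := H.hd
  rw [zero_pow (by omega)] at this
  simpa using this

theorem key (H : Hyp d F₀ F₁) (m l : ℕ) : ∃ b : MvPolynomial (Fin 2) ℂ,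
    (Pp F₀ F₁ (m + l) * (Fp F₀ F₁ m).1 = Pp F₀ F₁ l * b * X 0 + Pp F₀ F₁ m * (Fp F₀ F₁ (m + l)).1) ∧
    (Pp F₀ F₁ (m + l) * (Fp F₀ F₁ m).2 = Pp F₀ F₁ l * b * X 1 + Pp F₀ F₁ m * (Fp F₀ F₁ (m + l)).2) := by
  have e1 : aeval ![(Fp F₀ F₁ l).1, (Fp F₀ F₁ l).2] (Fp F₀ F₁ m).1 = (Fp F₀ F₁ (m + l)).1 := by
    apply ev_funext; intro Z
    rw [ev_comp, Fp_ev, Fp_ev1, Fp_ev1, Function.iterate_add_apply]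
  have e2 : aeval ![(Fp F₀ F₁ l).1, (Fp F₀ F₁ l).2] (Fp F₀ F₁ m).2 = (Fp F₀ F₁ (m + l)).2 := by
    apply ev_funext; intro Z
    rw [ev_comp, Fp_ev, Fp_ev2, Fp_ev2, Function.iterate_add_apply]
  have e3 (p : MvPolynomial (Fin 2) ℂ) : aeval ![(X 0 : MvPolynomial (Fin 2) ℂ), X 1] p = p := by
    apply ev_funext; intro Z
    rw [ev_comp, ev_X0, ev_X1]
  obtain ⟨b, hb⟩ := bez (H.Fp_hom m).1 (H.Fp_hom m).2 (Fp F₀ F₁ l).1 (Fp F₀ F₁ l).2 (X 0) (X 1)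
  rw [e1, e2, e3, e3] at hb
  refine ⟨b, ?_, ?_⟩
  · unfold Pp
    linear_combination X 0 * hb
  · unfold Pp
    linear_combination X 1 * hb

end Hyp

/-- absolute value of product of linear forms -/
noncomputable def af (S : Multiset (ℂ × ℂ)) (Z : ℂ × ℂ) : ℝ := (S.map (fun B => ‖wedge Z B‖)).prod

theorem norm_msprod {α : Type*} (S : Multiset α) (f : α → ℂ) : ‖(S.map f).prod‖ = (S.map (fun a => ‖f a‖)).prod := by
  induction S using Multiset.induction_on with
  | empty => simp
  | cons a s ih => simp [ih]

theorem af_eq (S : Multiset (ℂ × ℂ)) (Z) : ‖ev (S.map Lf).prod Z‖ = af S Z := by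
  rw [ev_msprod, norm_msprod]; rfl

theorem af_add (S T : Multiset (ℂ × ℂ)) (Z) : af (S + T) Z = af S Z * af T Z := by simp [af]

theorem af_smul (S : Multiset (ℂ × ℂ)) (t : ℂ) (Z) : af S (t • Z) = ‖t‖ ^ (Multiset.card S) * af S Z := by
  unfold af
  simp only [wedge_smul_left, norm_mul, Multiset.prod_map_mul]
  simp

theorem af_swap (S T : Multiset (ℂ × ℂ)) : (S.map (af T)).prod = (T.map (af S)).prod := by
  unfold af
  rw [Multiset.prod_map_prod_map]
  simp only [norm_wedge_comm]

theorem af_zero_of_mem {S : Multiset (ℂ × ℂ)} {B} (h : B ∈ S) : af S B = 0 := by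
  unfold af
  apply Multiset.prod_eq_zero
  rw [Multiset.mem_map]
  exact ⟨B, h, by simp [wedge_self]⟩

theorem mprod_div {α : Type*} (S : Multiset α) (f : α → ℝ) (c : ℝ) :
    (S.map (fun a => c * f a)).prod = c ^ (Multiset.card S) * (S.map f).prod := by
  simp [Multiset.prod_map_mul]

theorem par_norm {Z v : ℂ × ℂ} (hv : v ≠ 0) (h : wedge v Z = 0) :
    ∃ t : ℂ, Z = t • v ∧ ‖t‖ * ‖v‖ = ‖Z‖ := by
  rw [wedge_comm, neg_eq_zero] at h
  obtain ⟨t, rfl⟩ := wedge_eq_zero hv h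
  exact ⟨t, rfl, by rw [norm_smul]⟩

namespace Hyp
variable {d : ℕ} {F₀ F₁ : MvPolynomial (Fin 2) ℂ}

theorem nm1 (H : Hyp d F₀ F₁) (v : ℂ × ℂ) (hv : v ≠ 0) : ∃ c : ℝ, 0 < c ∧ ∃ S : Multiset (ℂ × ℂ),
    Multiset.card S = d ∧ (∀ Z, ‖wedge v (Fmap F₀ F₁ Z)‖ = c * af S Z) ∧
    c ^ d * (S.map (fun B => ‖Fmap F₀ F₁ B‖)).prod = ‖v‖ ^ d := by
  obtain ⟨T, hT, hTf, hTr⟩ := H.hres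
  have hd := H.hd
  have hTf' : ∀ Z, ‖ev F₀ Z‖ = af T Z := by
    intro Z; rw [hTf, norm_msprod]; rfl
  have hT0 : ∀ A ∈ T, ev F₀ A = 0 := by
    intro A hA
    rw [← norm_eq_zero, hTf', af_zero_of_mem hA]
  have hv' : 0 < ‖v‖ := norm_pos_iff.2 hv
  by_cases h0 : v.1 = 0
  · have hn : ‖v‖ = ‖v.2‖ := by simp [Prod.norm_def, h0]
    refine ⟨‖v.2‖, hn ▸ hv', T, hT, ?_, ?_⟩
    · intro Z
      simp [wedge, Fmap, h0, hTf']
    · have : (T.map (fun B => ‖Fmap F₀ F₁ B‖)) = T.map (fun B => ‖ev F₁ B‖) := by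
        apply Multiset.map_congr rfl
        intro B hB
        simp [Fmap, Prod.norm_def, hT0 B hB]
      rw [this, hTr, hn, mul_one]
  · set p := C v.1 * F₁ - C v.2 * F₀ with hp
    have hph : p.IsHomogeneous d := (H.h₁.C_mul _).sub (H.h₀.C_mul _)
    have hpe : ∀ Z, ev p Z = wedge v (Fmap F₀ F₁ Z) := by
      intro Z; simp [hp, ev_sub, ev_mul, ev_C, wedge, Fmap]
    have hpne : p ≠ 0 := by
      intro h
      obtain ⟨A, hA⟩ : ∃ A, A ∈ T := Multiset.card_pos_iff_exists_mem.1 (by omega)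
      have h1 := hpe A
      rw [h] at h1
      simp [ev, wedge, Fmap] at h1
      have h2 := hT0 A hA
      unfold ev at h2
      rw [h2] at h1
      have h3 : ev F₁ A = 0 := by simpa [h0, ev] using h1.symm
      have : (T.map (fun B => ‖ev F₁ B‖)).prod = 0 := by
        apply Multiset.prod_eq_zero
        rw [Multiset.mem_map]
        exact ⟨A, hA, by simp [h3]⟩
      rw [this] at hTr
      norm_num at hTr
    obtain ⟨c, hc, S, hS, hSn, hf⟩ := fac hph hpne
    have hc' : 0 < ‖c‖ := norm_pos_iff.2 hc
    have hSf : ∀ Z, ‖wedge v (Fmap F₀ F₁ Z)‖ = ‖c‖ * af S Z := by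
      intro Z
      rw [← hpe, hf, ev_mul, ev_C, norm_mul, af_eq]
    refine ⟨‖c‖, hc', S, hS, hSf, ?_⟩
    have h0' : 0 < ‖v.1‖ := norm_pos_iff.2 h0
    have e1 : ∀ B ∈ S, ‖Fmap F₀ F₁ B‖ = (‖v‖ / ‖v.1‖) * af T B := by
      intro B hB
      have : wedge v (Fmap F₀ F₁ B) = 0 := by
        rw [← norm_eq_zero, hSf, af_zero_of_mem hB, mul_zero]
      obtain ⟨t, ht, ht'⟩ := par_norm hv this
      rw [← ht', ← hTf']
      have : ev F₀ B = t * v.1 := by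
        have := congrArg Prod.fst ht
        simpa [Fmap] using this
      rw [this, norm_mul]
      field_simp
    rw [Multiset.map_congr rfl e1, mprod_div, hS, af_swap]
    have e2 : ∀ A ∈ T, af S A = (‖v.1‖ / ‖c‖) * ‖ev F₁ A‖ := by
      intro A hA
      have := hSf A
      simp only [wedge, Fmap, hT0 A hA, mul_zero, sub_zero, norm_mul] at this
      field_simp
      linarith
    rw [Multiset.map_congr rfl e2, mprod_div, hTr, hT]
    rw [mul_one, ← mul_pow, ← mul_pow]
    congr 1
    field_simp

theorem nm (H : Hyp d F₀ F₁) (m : ℕ) : ∀ (v : ℂ × ℂ) (_ : v ≠ 0), ∃ c : ℝ, 0 < c ∧ ∃ S : Multiset (ℂ × ℂ),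
    Multiset.card S = d ^ m ∧ (∀ Z, ‖wedge v ((Fmap F₀ F₁)^[m] Z)‖ = c * af S Z) ∧
    c ^ (d ^ m) * (S.map (fun B => ‖(Fmap F₀ F₁)^[m] B‖)).prod = ‖v‖ ^ (d ^ m) := by
  induction m with
  | zero =>
    intro v hv
    exact ⟨1, one_pos, {v}, by simp, by intro Z; simp [af, norm_wedge_comm v], by simp⟩
  | succ m ih =>
    intro v hv
    obtain ⟨c, hc, S, hS, hSf, hSr⟩ := H.nm1 v hv
    have hv' : 0 < ‖v‖ := norm_pos_iff.2 hv
    have hSn : ∀ B ∈ S, B ≠ 0 := by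
      rintro B hB rfl
      have : (S.map (fun B => ‖Fmap F₀ F₁ B‖)).prod = 0 := by
        apply Multiset.prod_eq_zero
        rw [Multiset.mem_map]
        exact ⟨0, hB, by simp [H.F_zero]⟩
      rw [this, mul_zero] at hSr
      have := pow_pos hv' d
      linarith
    have ih' : ∀ B : ℂ × ℂ, ∃ (c : ℝ) (S : Multiset (ℂ × ℂ)), B ≠ 0 → 0 < c ∧
      Multiset.card S = d ^ m ∧ (∀ Z, ‖wedge B ((Fmap F₀ F₁)^[m] Z)‖ = c * af S Z) ∧
      c ^ (d ^ m) * (S.map (fun B => ‖(Fmap F₀ F₁)^[m] B‖)).prod = ‖B‖ ^ (d ^ m) := by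
      intro B
      by_cases hB : B = 0
      · exact ⟨0, 0, fun h => absurd hB h⟩
      · obtain ⟨c, h1, S, h2⟩ := ih B hB
        exact ⟨c, S, fun _ => ⟨h1, h2⟩⟩
    choose cB SB hSB using ih'
    have hpos : 0 < (S.map cB).prod := by
      apply Multiset.prod_pos
      intro a ha
      rw [Multiset.mem_map] at ha
      obtain ⟨B, hB, rfl⟩ := ha
      exact (hSB B (hSn B hB)).1
    refine ⟨c * (S.map cB).prod, mul_pos hc hpos, S.bind SB, ?_, ?_, ?_⟩
    · rw [Multiset.card_bind]
      have : ∀ B ∈ S, (Multiset.card ∘ SB) B = d ^ m := fun B hB => (hSB B (hSn B hB)).2.1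
      rw [Multiset.map_congr rfl this]
      simp [hS, pow_succ, mul_comm]
    · intro Z
      rw [Function.iterate_succ_apply', hSf, mul_assoc]
      congr 1
      unfold af
      rw [Multiset.map_bind, Multiset.prod_bind, ← Multiset.prod_map_mul]
      congr 1
      apply Multiset.map_congr rfl
      intro B hB
      rw [norm_wedge_comm, (hSB B (hSn B hB)).2.2.1]
      rfl
    · rw [Multiset.map_bind, Multiset.prod_bind]
      have e : ∀ B ∈ S, (Multiset.map (fun C => ‖(Fmap F₀ F₁)^[m + 1] C‖) (SB B)).prod =
          ‖Fmap F₀ F₁ B‖ ^ (d ^ m) * ((cB B) ^ (d ^ (m + 1)))⁻¹ := by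
        intro B hB
        obtain ⟨h1, h2, h3, h4⟩ := hSB B (hSn B hB)
        have hBn : 0 < ‖B‖ := norm_pos_iff.2 (hSn B hB)
        have e1 : ∀ C ∈ SB B, ‖(Fmap F₀ F₁)^[m + 1] C‖ =
            (‖Fmap F₀ F₁ B‖ / ‖B‖ ^ d) * ‖(Fmap F₀ F₁)^[m] C‖ ^ d := by
          intro C hC
          have : wedge B ((Fmap F₀ F₁)^[m] C) = 0 := by
            rw [← norm_eq_zero, h3, af_zero_of_mem hC, mul_zero]
          obtain ⟨t, ht, ht'⟩ := par_norm (hSn B hB) this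
          rw [Function.iterate_succ_apply', ← ht', ht, H.F_smul, norm_smul, norm_pow]
          field_simp
          ring
        rw [Multiset.map_congr rfl e1, mprod_div, h2, Multiset.prod_map_pow]
        have h5 : (Multiset.map (fun C => ‖(Fmap F₀ F₁)^[m] C‖) (SB B)).prod = ‖B‖ ^ (d ^ m) / cB B ^ (d ^ m) := by
          field_simp; linarith
        rw [h5, pow_succ d m]
        simp only [div_pow, ← pow_mul]
        rw [mul_comm (d ^ m) d]
        field_simp
      rw [Multiset.map_congr rfl e, Multiset.prod_map_mul, Multiset.prod_map_pow, Multiset.prod_map_inv,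
        Multiset.prod_map_pow]
      have h6 : (Multiset.map (fun B => ‖Fmap F₀ F₁ B‖) S).prod = ‖v‖ ^ d / c ^ d := by
        field_simp; linarith
      rw [h6, mul_pow, pow_succ d m]
      simp only [div_pow, ← pow_mul]
      rw [mul_comm (d ^ m) d]
      field_simp

end Hyp


/-- normalized projectively periodic point -/
def Nz (F₀ F₁ : MvPolynomial (Fin 2) ℂ) (B : ℂ × ℂ) : Prop :=
  B ≠ 0 ∧ ∃ m : ℕ, 1 ≤ m ∧ ∃ c : ℂ, ‖c‖ = 1 ∧ (Fmap F₀ F₁)^[m] B = c • B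

namespace Hyp
variable {d : ℕ} {F₀ F₁ : MvPolynomial (Fin 2) ℂ}

theorem dpow (H : Hyp d F₀ F₁) {m : ℕ} (hm : 1 ≤ m) : 2 ≤ d ^ m :=
  H.hd.trans (Nat.le_self_pow (by omega) d)

theorem af_of_all {S : Multiset (ℂ × ℂ)} {v : ℂ × ℂ} (h : ∀ A ∈ S, ∃ t : ℂ, A = t • v) (D : ℕ)
    (hD : Multiset.card S = D) :
    ∃ r : ℝ, ∀ Z, af S Z = r * ‖wedge Z v‖ ^ D := by
  subst hD
  induction S using Multiset.induction_on with
  | empty => exact ⟨1, by simp [af]⟩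
  | cons a s ih =>
    obtain ⟨r, hr⟩ := ih (fun A hA => h A (Multiset.mem_cons_of_mem hA))
    obtain ⟨t, ht⟩ := h a (Multiset.mem_cons_self a s)
    refine ⟨‖t‖ * r, fun Z => ?_⟩
    have : af (a ::ₘ s) Z = ‖wedge Z a‖ * af s Z := by simp [af]
    rw [this, hr, ht, wedge_smul_right, norm_mul, Multiset.card_cons, pow_succ]
    ring

theorem Pp_ne (H : Hyp d F₀ F₁) {m : ℕ} (hm : 1 ≤ m) : Pp F₀ F₁ m ≠ 0 := by
  intro h
  have hP : ∀ Z, wedge ((Fmap F₀ F₁)^[m] Z) Z = 0 := by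
    intro Z; rw [← Pp_ev, h]; simp [ev]
  have gen : ∀ v : ℂ × ℂ, v ≠ 0 → ∃ r : ℝ, ∀ Z, ‖wedge v ((Fmap F₀ F₁)^[m] Z)‖ = r * ‖wedge Z v‖ ^ (d ^ m) := by
    intro v hv
    obtain ⟨c, hc, S, hS, hSf, hSr⟩ := H.nm m v hv
    have hv' : 0 < ‖v‖ := norm_pos_iff.2 hv
    obtain ⟨r, hr⟩ := af_of_all (S := S) (v := v) (by
      intro A hA
      have : wedge v ((Fmap F₀ F₁)^[m] A) = 0 := by
        rw [← norm_eq_zero, hSf, af_zero_of_mem hA, mul_zero]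
      obtain ⟨t, ht, ht'⟩ := par_norm hv this
      have h2 := hP A
      rw [ht, wedge_smul_left] at h2
      have ht0 : t ≠ 0 := by
        rintro rfl
        have : (S.map (fun B => ‖(Fmap F₀ F₁)^[m] B‖)).prod = 0 := by
          apply Multiset.prod_eq_zero
          rw [Multiset.mem_map]
          exact ⟨A, hA, by simp [ht]⟩
        rw [this, mul_zero] at hSr
        have := pow_pos hv' (d ^ m)
        linarith
      have h3 : wedge v A = 0 := by simpa [ht0] using h2
      obtain ⟨t, ht, -⟩ := par_norm hv h3
      exact ⟨t, ht⟩) _ hS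
    refine ⟨c * r, fun Z => ?_⟩
    rw [hSf, hr, mul_assoc]
  obtain ⟨r, hr⟩ := gen (0, 1) (by simp)
  obtain ⟨s, hs⟩ := gen (1, 0) (by simp)
  have a1 := hr (1, 1)
  have a2 := hs (1, 1)
  have a3 := hr (1, 2)
  have a4 := hs (1, 2)
  have b1 := hP (1, 1)
  have b2 := hP (1, 2)
  have hne : (Fmap F₀ F₁)^[m] (1, 1) ≠ 0 := H.it_ne m (by simp)
  simp only [wedge] at a1 a2 a3 a4 b1 b2
  simp at a1 a2 a3 a4 b1 b2
  have hrs : r = s := by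
    rw [← a1, ← a2]
    congr 1
    linear_combination b1
  have b3 : ((Fmap F₀ F₁)^[m] (1, 2)).2 = ((Fmap F₀ F₁)^[m] (1, 2)).1 * 2 := by linear_combination -b2
  rw [b3, norm_mul, a3] at a4
  have hr0 : r ≠ 0 := by
    rintro rfl
    apply hne
    rw [← hrs] at a2
    ext
    · simpa using a1
    · simpa using a2
  rw [← hrs] at a4
  have h2 : (2 : ℝ) = 2 ^ (d ^ m) := by
    have := mul_left_cancel₀ hr0 a4
    simpa using this
  have h3 : (2 : ℕ) = 2 ^ (d ^ m) := by exact_mod_cast h2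
  have h4 := H.dpow hm
  have h5 : 2 ^ 2 ≤ 2 ^ (d ^ m) := Nat.pow_le_pow_right (by norm_num) h4
  omega

theorem Pp_exists (H : Hyp d F₀ F₁) {m : ℕ} (hm : 1 ≤ m) : ∃ v, v ≠ 0 ∧ ev (Pp F₀ F₁ m) v ≠ 0 := by
  by_contra! h
  apply H.Pp_ne hm
  apply hom_ext (H.Pp_hom m) (isHomogeneous_zero _ _ _)
  intro w
  rw [h (1, w) (by simp)]; simp [ev]

theorem normlem (H : Hyp d F₀ F₁) {m : ℕ} (hm : 1 ≤ m) {S : Multiset (ℂ × ℂ)} {κ : ℝ} (hκ : 0 < κ)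
    (hS : ∀ Z, ‖ev (Pp F₀ F₁ m) Z‖ = κ * af S Z) :
    κ ^ (d ^ m - 1) * (S.map (fun B => ‖(Fmap F₀ F₁)^[m] B‖)).prod = (S.map (fun B => ‖B‖)).prod := by
  obtain ⟨v, hv, hvP⟩ := H.Pp_exists hm
  have hvP' : 0 < ‖ev (Pp F₀ F₁ m) v‖ := norm_pos_iff.2 hvP
  have haf : 0 < af S v := by
    rw [hS] at hvP'
    exact pos_of_mul_pos_right hvP' hκ.le
  have hcard : Multiset.card S = d ^ m + 1 := by
    have h1 := hS ((2 : ℂ) • v)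
    rw [ev_hom (H.Pp_hom m), norm_mul, hS, af_smul, norm_pow] at h1
    have h2 : (2 : ℝ) ^ (d ^ m + 1) = 2 ^ (Multiset.card S) := by
      have : κ * af S v ≠ 0 := by positivity
      apply mul_right_cancel₀ this
      simp at h1
      rw [h1]; ring
    exact ((pow_right_injective₀ (by norm_num) (by norm_num)) h2).symm
  obtain ⟨c, hc, T, hT, hTf, hTr⟩ := H.nm m v hv
  have hv' : 0 < ‖v‖ := norm_pos_iff.2 hv
  have hSn : ∀ B ∈ S, B ≠ 0 := by
    rintro B hB rfl
    have : af S v = 0 := by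
      apply Multiset.prod_eq_zero
      rw [Multiset.mem_map]
      exact ⟨0, hB, by simp [wedge]⟩
    linarith
  have e1 : ∀ B ∈ S, af T B = c⁻¹ * ((‖(Fmap F₀ F₁)^[m] B‖ * (‖B‖)⁻¹) * ‖wedge v B‖) := by
    intro B hB
    have : wedge B ((Fmap F₀ F₁)^[m] B) = 0 := by
      rw [← norm_eq_zero, norm_wedge_comm, ← Pp_ev, hS, af_zero_of_mem hB, mul_zero]
    obtain ⟨t, ht, ht'⟩ := par_norm (hSn B hB) this
    have hB0 : 0 < ‖B‖ := norm_pos_iff.2 (hSn B hB)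
    have h1 := hTf B
    rw [ht, wedge_smul_right, norm_mul] at h1
    rw [← ht']
    field_simp
    linarith
  have e2 : ∀ A ∈ T, af S A = (κ⁻¹ * ‖v‖⁻¹) * (‖(Fmap F₀ F₁)^[m] A‖ * ‖wedge v A‖) := by
    intro A hA
    have : wedge v ((Fmap F₀ F₁)^[m] A) = 0 := by
      rw [← norm_eq_zero, hTf, af_zero_of_mem hA, mul_zero]
    obtain ⟨t, ht, ht'⟩ := par_norm hv this
    have h1 := hS A
    rw [Pp_ev, ht, wedge_smul_left, norm_mul] at h1
    rw [← ht']
    field_simp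
    linarith
  have sw := af_swap S T
  rw [Multiset.map_congr rfl e1, Multiset.map_congr rfl e2, mprod_div, mprod_div, Multiset.prod_map_mul,
    Multiset.prod_map_mul, Multiset.prod_map_mul, Multiset.prod_map_inv, hT, hcard] at sw
  change c⁻¹ ^ (d ^ m + 1) * (_ * af S v) = _ * (_ * af T v) at sw
  have r1 : ‖ev (Pp F₀ F₁ m) v‖ = c * af T v := by
    rw [← hTf, Pp_ev, norm_wedge_comm]
  have haT : af T v = κ * af S v / c := by
    rw [← hS, r1]; field_simp
  set p1 := (S.map (fun B => ‖(Fmap F₀ F₁)^[m] B‖)).prod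
  set p2 := (S.map (fun B => ‖B‖)).prod
  have hp2 : 0 < p2 := by
    apply Multiset.prod_pos
    intro a ha
    rw [Multiset.mem_map] at ha
    obtain ⟨B, hB, rfl⟩ := ha
    exact norm_pos_iff.2 (hSn B hB)
  have hTr' : (T.map (fun B => ‖(Fmap F₀ F₁)^[m] B‖)).prod = ‖v‖ ^ (d ^ m) / c ^ (d ^ m) := by
    field_simp; linarith
  rw [hTr', haT] at sw
  have hdm : d ^ m = (d ^ m - 1) + 1 := by have := H.dpow hm; omega
  set D := d ^ m - 1
  rw [hdm] at sw
  have q1 : c * (1 / c) ^ (D + 1 + 1) * c ^ (D + 1) = 1 := by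
    rw [one_div, inv_pow, pow_succ c (D + 1)]; field_simp
  have q2 : κ * (1 / (κ * ‖v‖)) ^ (D + 1) * ‖v‖ ^ (D + 1) * κ ^ D = 1 := by
    rw [one_div, inv_pow, mul_pow, pow_succ κ D]; field_simp
  field_simp at sw
  linear_combination κ ^ D * sw - κ ^ D * p1 * q1 + p2 * q2

theorem it_mul (H : Hyp d F₀ F₁) {m : ℕ} {B : ℂ × ℂ} {c : ℂ} (h : (Fmap F₀ F₁)^[m] B = c • B) (k : ℕ) :
    ∃ e : ℕ, (Fmap F₀ F₁)^[m * k] B = c ^ e • B ∧ (1 ≤ k → 1 ≤ e) := by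
  induction k with
  | zero => exact ⟨0, by simp, by simp⟩
  | succ k ih =>
    obtain ⟨e, he, -⟩ := ih
    refine ⟨1 + d ^ m * e, ?_, fun _ => by omega⟩
    rw [mul_add, mul_one, add_comm, Function.iterate_add_apply, he, H.it_smul, h, smul_smul]
    congr 1
    rw [pow_add, pow_mul]; ring

/-- consistency of the normalization -/
theorem nz_norm (H : Hyp d F₀ F₁) {B : ℂ × ℂ} (hB : Nz F₀ F₁ B) {m : ℕ} (hm : 1 ≤ m) {c : ℂ}
    (h : (Fmap F₀ F₁)^[m] B = c • B) : ‖c‖ = 1 := by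
  obtain ⟨hB0, k, hk, c', hc', h'⟩ := hB
  obtain ⟨e, he, he1⟩ := H.it_mul h k
  obtain ⟨e', he', -⟩ := H.it_mul h' m
  rw [mul_comm, he] at he'
  have := smul_left_injective ℂ hB0 he'
  have h2 : ‖c‖ ^ e = 1 := by rw [← norm_pow, this, norm_pow, hc', one_pow]
  exact (pow_eq_one_iff_of_nonneg (norm_nonneg _) (by have := he1 hk; omega)).1 h2

theorem nz_fix (H : Hyp d F₀ F₁) {B : ℂ × ℂ} (hB : Nz F₀ F₁ B) {m : ℕ} (hm : 1 ≤ m)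
    (h : ev (Pp F₀ F₁ m) B = 0) : ∃ c : ℂ, ‖c‖ = 1 ∧ (Fmap F₀ F₁)^[m] B = c • B := by
  rw [Pp_ev] at h
  obtain ⟨c, hc⟩ := wedge_eq_zero hB.1 h
  exact ⟨c, H.nz_norm hB hm hc, hc⟩

theorem nz_F (H : Hyp d F₀ F₁) {B : ℂ × ℂ} (hB : Nz F₀ F₁ B) : Nz F₀ F₁ (Fmap F₀ F₁ B) := by
  obtain ⟨hB0, k, hk, c', hc', h'⟩ := hB
  refine ⟨H.F_ne hB0, k, hk, c' ^ d, by simp [hc'], ?_⟩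
  rw [← Function.iterate_succ_apply, Function.iterate_succ_apply', h', H.F_smul]

theorem nz_it (H : Hyp d F₀ F₁) {B : ℂ × ℂ} (hB : Nz F₀ F₁ B) (k : ℕ) : Nz F₀ F₁ ((Fmap F₀ F₁)^[k] B) := by
  induction k with
  | zero => simpa
  | succ k ih => rw [Function.iterate_succ_apply']; exact H.nz_F ih

theorem nz_smul (H : Hyp d F₀ F₁) {B : ℂ × ℂ} (hB : Nz F₀ F₁ B) {t : ℂ} (ht : Nz F₀ F₁ (t • B)) : ‖t‖ = 1 := by
  obtain ⟨hB0, k, hk, c', hc', h'⟩ := hB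
  have ht0 : t ≠ 0 := by rintro rfl; exact ht.1 (by simp)
  have hD := H.dpow hk
  have h1 : (Fmap F₀ F₁)^[k] (t • B) = (t ^ (d ^ k - 1) * c') • (t • B) := by
    rw [H.it_smul, h', smul_smul, smul_smul]
    congr 1
    have : t ^ (d ^ k) = t ^ (d ^ k - 1) * t := by rw [← pow_succ]; congr 1; omega
    rw [this]; ring
  have h2 := H.nz_norm ht hk h1
  rw [norm_mul, hc', mul_one, norm_pow] at h2
  exact (pow_eq_one_iff_of_nonneg (norm_nonneg _) (by omega)).1 h2

theorem nz_exists (H : Hyp d F₀ F₁) {B : ℂ × ℂ} (hB : B ≠ 0) {m : ℕ} (hm : 1 ≤ m)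
    (h : ev (Pp F₀ F₁ m) B = 0) : ∃ ν : ℝ, 0 < ν ∧ ∃ B', Nz F₀ F₁ B' ∧ B = (ν : ℂ) • B' := by
  rw [Pp_ev] at h
  obtain ⟨c, hc⟩ := wedge_eq_zero hB h
  have hD := H.dpow hm
  have hc0 : c ≠ 0 := by
    rintro rfl; exact H.it_ne m hB (by simpa using hc)
  have hc' : 0 < ‖c‖ := norm_pos_iff.2 hc0
  set ν : ℝ := ‖c‖ ^ ((1 : ℝ) / ((d ^ m - 1 : ℕ) : ℝ)) with hν
  have hν0 : 0 < ν := Real.rpow_pos_of_pos hc' _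
  have hνp : ν ^ (d ^ m - 1) = ‖c‖ := by
    rw [hν, ← Real.rpow_natCast, ← Real.rpow_mul hc'.le, one_div_mul_cancel, Real.rpow_one]
    have : d ^ m - 1 ≠ 0 := by omega
    exact_mod_cast this
  have hν1 : (ν : ℂ) ≠ 0 := by exact_mod_cast hν0.ne'
  refine ⟨ν, hν0, (ν : ℂ)⁻¹ • B, ⟨by simp [hB, hν1], m, hm, c * ((ν : ℂ) ^ (d ^ m - 1))⁻¹, ?_, ?_⟩, ?_⟩
  · rw [norm_mul, norm_inv, norm_pow, Complex.norm_real, Real.norm_of_nonneg hν0.le, hνp]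
    field_simp
  · rw [H.it_smul, hc, smul_smul, smul_smul]
    congr 1
    have : (ν : ℂ)⁻¹ ^ (d ^ m) = ((ν : ℂ) ^ (d ^ m - 1))⁻¹ * (ν : ℂ)⁻¹ := by
      rw [← inv_pow, ← pow_succ]; congr 1; omega
    rw [this]; ring
  · rw [smul_smul, mul_inv_cancel₀ hν1, one_smul]

theorem mnormalize (H : Hyp d F₀ F₁) {m : ℕ} (hm : 1 ≤ m) {S : Multiset (ℂ × ℂ)} (hS : ∀ B ∈ S, B ≠ 0)
    (hz : ∀ B ∈ S, ev (Pp F₀ F₁ m) B = 0) : ∃ κ : ℝ, 0 < κ ∧ ∃ S', (∀ B ∈ S', Nz F₀ F₁ B) ∧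
      ∀ Z, af S Z = κ * af S' Z := by
  induction S using Multiset.induction_on with
  | empty => exact ⟨1, one_pos, 0, by simp, by simp⟩
  | cons a s ih =>
    obtain ⟨κ, hκ, S', hS', h⟩ := ih (fun A hA => hS A (Multiset.mem_cons_of_mem hA))
      (fun A hA => hz A (Multiset.mem_cons_of_mem hA))
    obtain ⟨ν, hν, B', hB', e⟩ := H.nz_exists (hS a (Multiset.mem_cons_self a s)) hm (hz a (Multiset.mem_cons_self a s))
    refine ⟨ν * κ, mul_pos hν hκ, B' ::ₘ S', ?_, fun Z => ?_⟩
    · intro B hB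
      rw [Multiset.mem_cons] at hB
      rcases hB with rfl | hB
      · exact hB'
      · exact hS' B hB
    · have h1 : af (a ::ₘ s) Z = ‖wedge Z a‖ * af s Z := by simp [af]
      have h2 : af (B' ::ₘ S') Z = ‖wedge Z B'‖ * af S' Z := by simp [af]
      rw [h1, h2, h, e, wedge_smul_right, norm_mul, Complex.norm_real, Real.norm_of_nonneg hν.le]
      ring

theorem norm_one (H : Hyp d F₀ F₁) {m : ℕ} (hm : 1 ≤ m) {S : Multiset (ℂ × ℂ)} {κ : ℝ} (hκ : 0 < κ)
    (hS : ∀ Z, ‖ev (Pp F₀ F₁ m) Z‖ = κ * af S Z) (hN : ∀ B ∈ S, Nz F₀ F₁ B) : κ = 1 := by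
  have h := H.normlem hm hκ hS
  have e : ∀ B ∈ S, ‖(Fmap F₀ F₁)^[m] B‖ = ‖B‖ := by
    intro B hB
    obtain ⟨c, hc, h⟩ := H.nz_fix (hN B hB) hm (by rw [← norm_eq_zero, hS, af_zero_of_mem hB, mul_zero])
    rw [h, norm_smul, hc, one_mul]
  rw [Multiset.map_congr rfl e] at h
  have hp2 : 0 < (S.map (fun B => ‖B‖)).prod := by
    apply Multiset.prod_pos
    intro a ha
    rw [Multiset.mem_map] at ha
    obtain ⟨B, hB, rfl⟩ := ha
    exact norm_pos_iff.2 (hN B hB).1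
  have h2 : κ ^ (d ^ m - 1) = 1 := by
    apply mul_right_cancel₀ hp2.ne'
    rw [h, one_mul]
  have := H.dpow hm
  exact (pow_eq_one_iff_of_nonneg hκ.le (by omega)).1 h2

end Hyp

theorem divlem {y0 y1 : MvPolynomial (Fin 2) ℂ} (hy : ∀ Z : ℂ × ℂ, Z ≠ 0 → ev y0 Z = 0 → ev y1 Z ≠ 0)
    (S : Multiset (ℂ × ℂ)) (hS : ∀ B ∈ S, B ≠ 0) :
    ∀ (c : ℂ) (_ : c ≠ 0) (T : Multiset (ℂ × ℂ)) (_ : ∀ B ∈ T, B ≠ 0)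
      (_ : (S.map Lf).prod ∣ C c * (T.map Lf).prod * y0) (_ : (S.map Lf).prod ∣ C c * (T.map Lf).prod * y1),
      ∃ c' : ℂ, c' ≠ 0 ∧ ∃ T' : Multiset (ℂ × ℂ), (∀ B ∈ T', B ≠ 0) ∧
        C c * (T.map Lf).prod = (S.map Lf).prod * (C c' * (T'.map Lf).prod) := by
  induction S using Multiset.induction_on with
  | empty => intro c hc T hT _ _; exact ⟨c, hc, T, hT, by simp⟩
  | cons a s ih =>
    intro c hc T hT h0 h1
    have ha := hS a (Multiset.mem_cons_self a s)
    simp only [Multiset.map_cons, Multiset.prod_cons] at h0 h1 ⊢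
    have hz : ev (C c * (T.map Lf).prod) a = 0 := by
      obtain ⟨q0, hq0⟩ := h0
      obtain ⟨q1, hq1⟩ := h1
      have a0 : ev (C c * (T.map Lf).prod * y0) a = 0 := by
        rw [hq0, ev_mul, ev_mul, ev_Lf, wedge_self]; ring
      have a1 : ev (C c * (T.map Lf).prod * y1) a = 0 := by
        rw [hq1, ev_mul, ev_mul, ev_Lf, wedge_self]; ring
      rw [ev_mul] at a0 a1
      rcases mul_eq_zero.1 a0 with h | h
      · exact h
      · exact (mul_eq_zero.1 a1).resolve_right (hy a ha h)
    rw [ev_mul, ev_C, ev_msprod] at hz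
    have hz' := (mul_eq_zero.1 hz).resolve_left hc
    rw [Multiset.prod_eq_zero_iff, Multiset.mem_map] at hz'
    obtain ⟨B, hB, hBz⟩ := hz'
    obtain ⟨t, ht, -⟩ := par_norm ha hBz
    have ht0 : t ≠ 0 := by rintro rfl; exact hT B hB (by simpa using ht)
    obtain ⟨T', rfl⟩ := Multiset.exists_cons_of_mem hB
    have hL : Lf B = C t * Lf a := by
      apply ev_funext; intro Z
      rw [ev_mul, ev_Lf, ev_Lf, ev_C, ht, wedge_smul_right]
    have e : C c * ((B ::ₘ T').map Lf).prod = Lf a * (C (c * t) * (T'.map Lf).prod) := by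
      simp only [Multiset.map_cons, Multiset.prod_cons, hL, C_mul]; ring
    rw [e] at h0 h1 ⊢
    rw [mul_assoc, mul_dvd_mul_iff_left (Lf_ne ha)] at h0 h1
    obtain ⟨c', hc', T'', hT'', h⟩ := ih (fun A hA => hS A (Multiset.mem_cons_of_mem hA)) (c * t)
      (mul_ne_zero hc ht0) T' (fun A hA => hT A (Multiset.mem_cons_of_mem hA)) h0 h1
    exact ⟨c', hc', T'', hT'', by rw [h]; ring⟩

namespace Hyp
variable {d : ℕ} {F₀ F₁ : MvPolynomial (Fin 2) ℂ}

theorem pdvd (H : Hyp d F₀ F₁) {g : ℕ} (hg : 1 ≤ g) (a : ℕ) :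
    ∃ c : ℂ, c ≠ 0 ∧ ∃ T : Multiset (ℂ × ℂ), (∀ B ∈ T, B ≠ 0) ∧
      Pp F₀ F₁ (g * (a + 1)) = Pp F₀ F₁ g * (C c * (T.map Lf).prod) := by
  induction a with
  | zero => exact ⟨1, one_ne_zero, 0, by simp, by simp⟩
  | succ a ih =>
    obtain ⟨c0, hc0, T0, hT0, h0⟩ := ih
    obtain ⟨b, hb1, hb2⟩ := H.key (g * (a + 1)) g
    have hm : g * (a + 1) + g = g * (a + 1 + 1) := by ring
    rw [hm] at hb1 hb2
    have hm1 : 1 ≤ g * (a + 1 + 1) := by nlinarith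
    obtain ⟨cS, hcS, S, hS, hSn, hSf⟩ := fac (H.Pp_hom g) (H.Pp_ne hg)
    obtain ⟨cT, hcT, T, hT, hTn, hTf⟩ := fac (H.Pp_hom (g * (a + 1 + 1))) (H.Pp_ne hm1)
    have d1 : (S.map Lf).prod ∣ Pp F₀ F₁ g := by rw [hSf]; exact dvd_mul_left _ _
    have d2 : Pp F₀ F₁ g ∣ Pp F₀ F₁ (g * (a + 1)) := by rw [h0]; exact dvd_mul_right _ _
    obtain ⟨c', hc', T', hT', h⟩ := divlem (y0 := (Fp F₀ F₁ (g * (a + 1))).1) (y1 := (Fp F₀ F₁ (g * (a + 1))).2)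
      (by
        intro Z hZ h0 h1
        apply H.it_ne (g * (a + 1)) hZ
        rw [← Fp_ev, h0, h1]; rfl) S hSn cT hcT T hTn
      (by
        rw [← hTf, hb1]
        exact d1.trans (dvd_add ((dvd_mul_right _ _).mul_right _) (d2.mul_right _)))
      (by
        rw [← hTf, hb2]
        exact d1.trans (dvd_add ((dvd_mul_right _ _).mul_right _) (d2.mul_right _)))
    refine ⟨cS⁻¹ * c', mul_ne_zero (inv_ne_zero hcS) hc', T', hT', ?_⟩
    rw [hTf, hSf, h]
    have : (C cS : MvPolynomial (Fin 2) ℂ) * C cS⁻¹ = 1 := by rw [← C_mul, mul_inv_cancel₀ hcS, C_1]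
    rw [C_mul]
    linear_combination (-(S.map Lf).prod * C c' * (T'.map Lf).prod) * this

theorem full (H : Hyp d F₀ F₁) {g : ℕ} (hg : 1 ≤ g) :
    ∃ U : Multiset (ℂ × ℂ), (∀ B ∈ U, Nz F₀ F₁ B) ∧ ∀ Z, ‖ev (Pp F₀ F₁ g) Z‖ = af U Z := by
  obtain ⟨c, hc, S, hS, hSn, hSf⟩ := fac (H.Pp_hom g) (H.Pp_ne hg)
  have hc' : 0 < ‖c‖ := norm_pos_iff.2 hc
  have h1 : ∀ Z, ‖ev (Pp F₀ F₁ g) Z‖ = ‖c‖ * af S Z := by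
    intro Z; rw [hSf, ev_mul, ev_C, norm_mul, af_eq]
  obtain ⟨κ, hκ, U, hU, h⟩ := H.mnormalize hg hSn (by
    intro B hB; rw [← norm_eq_zero, h1, af_zero_of_mem hB, mul_zero])
  have h2 : ∀ Z, ‖ev (Pp F₀ F₁ g) Z‖ = (‖c‖ * κ) * af U Z := by
    intro Z; rw [h1, h]; ring
  refine ⟨U, hU, fun Z => ?_⟩
  rw [h2, H.norm_one hg (mul_pos hc' hκ) h2 hU, one_mul]

theorem quot (H : Hyp d F₀ F₁) {g m : ℕ} (hg : 1 ≤ g) (hm : 1 ≤ m) (hgm : g ∣ m) :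
    ∃ Q : MvPolynomial (Fin 2) ℂ, ∃ V : Multiset (ℂ × ℂ), Pp F₀ F₁ m = Pp F₀ F₁ g * Q ∧
      (∀ B ∈ V, Nz F₀ F₁ B) ∧ ∀ Z, ‖ev Q Z‖ = af V Z := by
  obtain ⟨a, rfl⟩ := hgm
  obtain ⟨a, rfl⟩ : ∃ b, a = b + 1 := ⟨a - 1, by
    have : a ≠ 0 := by rintro rfl; omega
    omega⟩
  obtain ⟨c, hc, T, hT, h⟩ := H.pdvd hg a
  have hc' : 0 < ‖c‖ := norm_pos_iff.2 hc
  have h1 : ∀ Z, ‖ev (C c * (T.map Lf).prod) Z‖ = ‖c‖ * af T Z := by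
    intro Z; rw [ev_mul, ev_C, norm_mul, af_eq]
  obtain ⟨κ, hκ, V, hV, hVf⟩ := H.mnormalize hm hT (by
    intro B hB; rw [← norm_eq_zero, h, ev_mul, norm_mul, h1, af_zero_of_mem hB]; simp)
  obtain ⟨U, hU, hUf⟩ := H.full hg
  have h2 : ∀ Z, ‖ev (Pp F₀ F₁ (g * (a + 1))) Z‖ = (‖c‖ * κ) * af (U + V) Z := by
    intro Z; rw [h, ev_mul, norm_mul, h1, hUf, hVf, af_add]; ring
  have h3 := H.norm_one hm (mul_pos hc' hκ) h2 (by
    intro B hB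
    rcases Multiset.mem_add.1 hB with hB | hB
    · exact hU B hB
    · exact hV B hB)
  refine ⟨_, V, h, hV, fun Z => ?_⟩
  rw [h1, hVf, ← mul_assoc, h3, one_mul]

theorem euclid (H : Hyp d F₀ F₁) : ∀ (N k l : ℕ) (_ : k + l ≤ N) (_ : 1 ≤ k) (_ : 1 ≤ l)
    (Qk Ql : MvPolynomial (Fin 2) ℂ) (S T : Multiset (ℂ × ℂ))
    (_ : Pp F₀ F₁ k = Pp F₀ F₁ (k.gcd l) * Qk) (_ : Pp F₀ F₁ l = Pp F₀ F₁ (k.gcd l) * Ql)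
    (_ : ∀ B ∈ S, Nz F₀ F₁ B) (_ : ∀ B ∈ T, Nz F₀ F₁ B)
    (_ : ∀ Z, ‖ev Qk Z‖ = af S Z) (_ : ∀ Z, ‖ev Ql Z‖ = af T Z), (T.map (af S)).prod = 1 := by
  intro N
  induction N with
  | zero => intro k l h hk hl; omega
  | succ N ih =>
    have main : ∀ (k l : ℕ) (_ : k + l ≤ N + 1) (_ : 1 ≤ k) (_ : 1 ≤ l) (_ : l < k)
      (Qk Ql : MvPolynomial (Fin 2) ℂ) (S T : Multiset (ℂ × ℂ))
      (_ : Pp F₀ F₁ k = Pp F₀ F₁ (k.gcd l) * Qk) (_ : Pp F₀ F₁ l = Pp F₀ F₁ (k.gcd l) * Ql)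
      (_ : ∀ B ∈ S, Nz F₀ F₁ B) (_ : ∀ B ∈ T, Nz F₀ F₁ B)
      (_ : ∀ Z, ‖ev Qk Z‖ = af S Z) (_ : ∀ Z, ‖ev Ql Z‖ = af T Z), (T.map (af S)).prod = 1 := by
      intro k l hN hk hl hlt Qk Ql S T hQk hQl hS hT hSf hTf
      obtain ⟨m, rfl⟩ : ∃ m, k = m + l := ⟨k - l, by omega⟩
      have hm : 1 ≤ m := by omega
      have hgcd : (m + l).gcd l = m.gcd l := by simp
      rw [hgcd] at hQk hQl
      have hg : 1 ≤ m.gcd l := Nat.gcd_pos_of_pos_left _ hm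
      obtain ⟨Qm, V, hQm, hV, hVf⟩ := H.quot hg hm (Nat.gcd_dvd_left m l)
      have hIH := ih m l (by omega) hm hl Qm Ql V T hQm hQl hV hT hVf hTf
      rw [← hIH]
      congr 1
      apply Multiset.map_congr rfl
      intro B hB
      rw [← hSf, ← hVf]
      obtain ⟨b, hb1, hb2⟩ := H.key m l
      have hPne := H.Pp_ne hg
      have hk1 : Qk * (Fp F₀ F₁ m).1 = Ql * b * X 0 + Qm * (Fp F₀ F₁ (m + l)).1 := by
        apply mul_left_cancel₀ hPne
        rw [hQk, hQl, hQm] at hb1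
        linear_combination hb1
      have hk2 : Qk * (Fp F₀ F₁ m).2 = Ql * b * X 1 + Qm * (Fp F₀ F₁ (m + l)).2 := by
        apply mul_left_cancel₀ hPne
        rw [hQk, hQl, hQm] at hb2
        linear_combination hb2
      have hQlB : ev Ql B = 0 := by rw [← norm_eq_zero, hTf, af_zero_of_mem hB]
      obtain ⟨c, hc, hcB⟩ := H.nz_fix (hT B hB) hl (by rw [hQl, ev_mul, hQlB, mul_zero])
      have e : (Fmap F₀ F₁)^[m + l] B = c ^ (d ^ m) • (Fmap F₀ F₁)^[m] B := by
        rw [Function.iterate_add_apply, hcB, H.it_smul]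
      have f1 := congrArg (fun p => ev p B) hk1
      have f2 := congrArg (fun p => ev p B) hk2
      simp only [ev_mul, ev_add, hQlB, Fp_ev1, Fp_ev2, e] at f1 f2
      have f3 : ev Qk B • (Fmap F₀ F₁)^[m] B = (ev Qm B * c ^ (d ^ m)) • (Fmap F₀ F₁)^[m] B := by
        ext
        · simp only [Prod.smul_fst, smul_eq_mul] at f1 ⊢; linear_combination f1
        · simp only [Prod.smul_snd, smul_eq_mul] at f2 ⊢; linear_combination f2
      have f4 : ev Qk B = ev Qm B * c ^ (d ^ m) :=
        smul_left_injective ℂ (H.it_ne m (hT B hB).1) f3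
      rw [f4, norm_mul, norm_pow, hc]; simp
    intro k l hN hk hl Qk Ql S T hQk hQl hS hT hSf hTf
    rcases lt_trichotomy k l with h | h | h
    · rw [af_swap]
      rw [Nat.gcd_comm] at hQk hQl
      exact main l k (by omega) hl hk h Ql Qk T S hQl hQk hT hS hTf hSf
    · subst h
      rw [Nat.gcd_self] at hQk
      have : Qk = 1 := by
        apply mul_left_cancel₀ (H.Pp_ne hk)
        rw [← hQk, mul_one]
      subst this
      have : ∀ B ∈ T, af S B = 1 := by
        intro B _; rw [← hSf, ev_one]; simp
      rw [Multiset.map_congr rfl this]; simp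
    · exact main k l hN hk hl h Qk Ql S T hQk hQl hS hT hSf hTf

end Hyp


noncomputable def Ph (dm : ℕ → ℕ) (Z : ℕ → ℕ → ℂ × ℂ) (k : ℕ) : MvPolynomial (Fin 2) ℂ :=
  ∏ j ∈ range (dm k), Lf (Z k j)

noncomputable def Mv (dm : ℕ → ℕ) (Z : ℕ → ℕ → ℂ × ℂ) (a : ℕ) (Q : MvPolynomial (Fin 2) ℂ) : ℝ :=
  ∏ j ∈ range (dm a), ‖ev Q (Z a j)‖

structure Dat (d : ℕ) (F₀ F₁ : MvPolynomial (Fin 2) ℂ) (n : ℕ) (dm : ℕ → ℕ) (Z : ℕ → ℕ → ℂ × ℂ) : Prop where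
  H : Hyp d F₀ F₁
  hn : 1 ≤ n
  nz : ∀ m, m ∣ n → ∀ j < dm m, Nz F₀ F₁ (Z m j)
  dyn : ∀ m, m ∣ n → Pp F₀ F₁ m = ∏ k ∈ m.divisors, Ph dm Z k

theorem Mv_mul (dm Z a Q R) : Mv dm Z a (Q * R) = Mv dm Z a Q * Mv dm Z a R := by
  simp [Mv, ev_mul, Finset.prod_mul_distrib]

theorem Mv_prod (dm Z a) {ι : Type*} (s : Finset ι) (f : ι → MvPolynomial (Fin 2) ℂ) :
    Mv dm Z a (∏ i ∈ s, f i) = ∏ i ∈ s, Mv dm Z a (f i) := by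
  simp only [Mv, ev_prod, norm_prod]
  rw [Finset.prod_comm]

theorem Mv_swap (dm Z a b) : Mv dm Z a (Ph dm Z b) = Mv dm Z b (Ph dm Z a) := by
  simp only [Mv, Ph, ev_prod, norm_prod, ev_Lf]
  rw [Finset.prod_comm]
  apply Finset.prod_congr rfl; intro i _
  apply Finset.prod_congr rfl; intro j _
  exact norm_wedge_comm _ _

noncomputable def Tm (dm : ℕ → ℕ) (Z : ℕ → ℕ → ℂ × ℂ) (D : Finset ℕ) : Multiset (ℂ × ℂ) :=
  ∑ a ∈ D, (range (dm a)).val.map (Z a)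

theorem Tm_map (dm Z) (D : Finset ℕ) (f : ℂ × ℂ → ℝ) :
    ((Tm dm Z D).map f).prod = ∏ a ∈ D, ∏ j ∈ range (dm a), f (Z a j) := by
  unfold Tm
  induction D using Finset.induction_on with
  | empty => simp
  | insert a s ha ih =>
    rw [Finset.sum_insert ha, Finset.prod_insert ha, Multiset.map_add, Multiset.prod_add, ih]
    rw [Multiset.map_map]; rfl

theorem Tm_mem {dm Z} {D : Finset ℕ} {B} (h : B ∈ Tm dm Z D) : ∃ a ∈ D, ∃ j < dm a, B = Z a j := by
  unfold Tm at h
  rw [Multiset.mem_sum] at h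
  obtain ⟨a, ha, h⟩ := h
  rw [Multiset.mem_map] at h
  obtain ⟨j, hj, rfl⟩ := h
  exact ⟨a, ha, j, by simpa using hj, rfl⟩

theorem Tm_af (dm Z) (D : Finset ℕ) (W) : ‖ev (∏ a ∈ D, Ph dm Z a) W‖ = af (Tm dm Z D) W := by
  rw [af, Tm_map]
  simp only [ev_prod, norm_prod, Ph, ev_Lf]

namespace Dat
variable {d n : ℕ} {F₀ F₁ : MvPolynomial (Fin 2) ℂ} {dm : ℕ → ℕ} {Z : ℕ → ℕ → ℂ × ℂ}

theorem pos (h : Dat d F₀ F₁ n dm Z) {k : ℕ} (hk : k ∣ n) : 1 ≤ k := Nat.pos_of_dvd_of_pos hk h.hn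

theorem dyn_quot (h : Dat d F₀ F₁ n dm Z) {k g : ℕ} (hk : k ∣ n) (hg : g ∣ k) :
    Pp F₀ F₁ k = Pp F₀ F₁ g * ∏ a ∈ k.divisors \ g.divisors, Ph dm Z a := by
  rw [h.dyn k hk, h.dyn g (hg.trans hk), mul_comm,
    Finset.prod_sdiff (Nat.divisors_subset_of_dvd (by have := h.pos hk; omega) hg)]

theorem one2 (h : Dat d F₀ F₁ n dm Z) (k : ℕ) : k ∣ n → ∀ s, 1 ≤ s → ¬ k ∣ s → ∀ Q,
    Pp F₀ F₁ s = Pp F₀ F₁ (s.gcd k) * Q → Mv dm Z k Q = 1 := by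
  induction k using Nat.strong_induction_on with
  | _ k ih =>
  intro hk s hs hks Q hQ
  have hk1 := h.pos hk
  have hg : 1 ≤ s.gcd k := Nat.gcd_pos_of_pos_left _ hs
  obtain ⟨Q', V, hQ', hV, hVf⟩ := h.H.quot hg hs (Nat.gcd_dvd_left s k)
  have hQQ : Q' = Q := by
    apply mul_left_cancel₀ (h.H.Pp_ne hg)
    rw [← hQ', ← hQ]
  subst hQQ
  set D := k.divisors \ (s.gcd k).divisors with hD
  have hmem : ∀ a ∈ D, a ∣ k ∧ ¬ a ∣ s := by
    intro a ha
    rw [hD, Finset.mem_sdiff, Nat.mem_divisors, Nat.mem_divisors] at ha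
    refine ⟨ha.1.1, fun h1 => ha.2 ⟨Nat.dvd_gcd h1 ha.1.1, by omega⟩⟩
  have hkD : k ∈ D := by
    rw [hD, Finset.mem_sdiff, Nat.mem_divisors, Nat.mem_divisors]
    exact ⟨⟨dvd_rfl, by omega⟩, fun h1 => hks (h1.1.trans (Nat.gcd_dvd_left s k))⟩
  have e := h.H.euclid (s + k) s k le_rfl hs hk1 Q' _ V (Tm dm Z D) hQ (h.dyn_quot hk (Nat.gcd_dvd_right s k)) hV
    (by
      intro B hB
      obtain ⟨a, ha, j, hj, rfl⟩ := Tm_mem hB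
      exact h.nz a ((hmem a ha).1.trans hk) j hj) hVf (Tm_af dm Z D)
  rw [Tm_map] at e
  have e2 : ∏ a ∈ D, Mv dm Z a Q' = 1 := by
    rw [← e]
    apply Finset.prod_congr rfl; intro a _
    apply Finset.prod_congr rfl; intro j _
    exact hVf _
  rw [← Finset.mul_prod_erase _ _ hkD] at e2
  rw [Finset.prod_eq_one, mul_one] at e2
  · exact e2
  intro a ha
  rw [Finset.mem_erase] at ha
  obtain ⟨hak, ha⟩ := ha
  obtain ⟨ha1, ha2⟩ := hmem a ha
  have halt : a < k := lt_of_le_of_ne (Nat.le_of_dvd hk1 ha1) hak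
  have han := ha1.trans hk
  have hgg : (s.gcd k).gcd a = s.gcd a := by
    rw [Nat.gcd_assoc, Nat.gcd_eq_right ha1]
  have hg' : 1 ≤ s.gcd a := Nat.gcd_pos_of_pos_left _ hs
  obtain ⟨Q2, _, hQ2, -, -⟩ := h.H.quot hg' hg (by rw [← hgg]; exact Nat.gcd_dvd_left _ _)
  have i1 := ih a halt han s hs ha2 (Q2 * Q') (by rw [hQ, hQ2, mul_assoc])
  have i2 := ih a halt han (s.gcd k) hg (fun h1 => ha2 (h1.trans (Nat.gcd_dvd_left s k))) Q2 (by rw [hgg, ← hQ2])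
  rwa [Mv_mul, i2, one_mul] at i1

theorem one (h : Dat d F₀ F₁ n dm Z) {a : ℕ} (ha : a ∣ n) (b : ℕ) : b ∣ n → ¬ a ∣ b → ¬ b ∣ a →
    Mv dm Z a (Ph dm Z b) = 1 := by
  induction b using Nat.strong_induction_on with
  | _ b ih =>
  intro hb hab hba
  have e := h.one2 a ha b (h.pos hb) hab _ (h.dyn_quot hb (Nat.gcd_dvd_left b a))
  have hb1 := h.pos hb
  have hmem : ∀ c ∈ b.divisors \ (b.gcd a).divisors, c ∣ b ∧ ¬ c ∣ a := by
    intro c hc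
    rw [Finset.mem_sdiff, Nat.mem_divisors, Nat.mem_divisors] at hc
    refine ⟨hc.1.1, fun h1 => hc.2 ⟨Nat.dvd_gcd hc.1.1 h1, ?_⟩⟩
    have := Nat.gcd_pos_of_pos_left a hb1
    omega
  have hbD : b ∈ b.divisors \ (b.gcd a).divisors := by
    rw [Finset.mem_sdiff, Nat.mem_divisors, Nat.mem_divisors]
    exact ⟨⟨dvd_rfl, by omega⟩, fun h1 => hba (h1.1.trans (Nat.gcd_dvd_right b a))⟩
  rw [Mv_prod, ← Finset.mul_prod_erase _ _ hbD, Finset.prod_eq_one, mul_one] at e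
  · exact e
  intro c hc
  rw [Finset.mem_erase] at hc
  obtain ⟨hcb, hc⟩ := hc
  obtain ⟨h1, h2⟩ := hmem c hc
  exact ih c (lt_of_le_of_ne (Nat.le_of_dvd hb1 h1) hcb) (h1.trans hb) (fun h3 => hab (h3.trans h1)) h2

end Dat


/-- dehomogenized iterate -/
noncomputable def hh (F₀ F₁ : MvPolynomial (Fin 2) ℂ) (m : ℕ) (w : ℂ) : ℂ :=
  ((Fmap F₀ F₁)^[m] (1, w)).2 / ((Fmap F₀ F₁)^[m] (1, w)).1

def Fx (F₀ F₁ : MvPolynomial (Fin 2) ℂ) (m : ℕ) (B : ℂ × ℂ) : Prop :=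
  ∃ c : ℂ, ‖c‖ = 1 ∧ (Fmap F₀ F₁)^[m] B = c • B

theorem hom_deg {P R Q : MvPolynomial (Fin 2) ℂ} {D r e : ℕ} (hP : P.IsHomogeneous D) (h0 : P ≠ 0)
    (hR : R.IsHomogeneous r) (hQ : Q.IsHomogeneous e) (h : P = R * Q) : D = r + e := by
  have := hR.mul hQ
  rw [← h] at this
  exact hP.inj_right this h0

namespace Hyp
variable {d : ℕ} {F₀ F₁ : MvPolynomial (Fin 2) ℂ}

theorem fx_mul (H : Hyp d F₀ F₁) {m : ℕ} {B : ℂ × ℂ} (h : Fx F₀ F₁ m B) (k : ℕ) : Fx F₀ F₁ (m * k) B := by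
  obtain ⟨c, hc, hB⟩ := h
  obtain ⟨e, he, -⟩ := H.it_mul hB k
  exact ⟨c ^ e, by simp [hc], he⟩

theorem base (H : Hyp d F₀ F₁) {m : ℕ} {B : ℂ × ℂ} (h : Fx F₀ F₁ m B) (hB : B.1 ≠ 0) :
    ∃ s : ℂ, s ≠ 0 ∧ ‖s‖ * ‖B.1‖ ^ (d ^ m) = ‖B.1‖ ∧
      (Fmap F₀ F₁)^[m] (1, B.2 / B.1) = s • ((1 : ℂ), B.2 / B.1) := by
  obtain ⟨c, hc, hB'⟩ := h
  have e1 : ((1 : ℂ), B.2 / B.1) = B.1⁻¹ • B := by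
    ext
    · simp [hB]
    · simp; field_simp
  have hn : ‖B.1‖ ≠ 0 := norm_ne_zero_iff.2 hB
  refine ⟨B.1⁻¹ ^ (d ^ m) * c * B.1, ?_, ?_, ?_⟩
  · have : c ≠ 0 := by rintro rfl; simp at hc
    positivity
  · simp [hc]; field_simp
  · rw [e1, H.it_smul, hB', smul_smul, smul_smul]
    congr 1
    field_simp

theorem hh_fix (H : Hyp d F₀ F₁) {m : ℕ} {B : ℂ × ℂ} (h : Fx F₀ F₁ m B) (hB : B.1 ≠ 0) :
    hh F₀ F₁ m (B.2 / B.1) = B.2 / B.1 := by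
  obtain ⟨s, hs, -, h1⟩ := H.base h hB
  rw [hh, h1]
  simp; field_simp

theorem den_ne (H : Hyp d F₀ F₁) {m : ℕ} {B : ℂ × ℂ} (h : Fx F₀ F₁ m B) (hB : B.1 ≠ 0) :
    ((Fmap F₀ F₁)^[m] (1, B.2 / B.1)).1 ≠ 0 := by
  obtain ⟨s, hs, -, h1⟩ := H.base h hB
  rw [h1]
  simpa using hs

theorem den_cont (m : ℕ) : Continuous (fun w : ℂ => ((Fmap F₀ F₁)^[m] (1, w)).1) := by
  have : (fun w : ℂ => ((Fmap F₀ F₁)^[m] (1, w)).1) = fun w => (un (Fp F₀ F₁ m).1).eval w := by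
    funext w; rw [un_eval, Fp_ev1]
  rw [this]; exact Polynomial.continuous _

theorem den_ev (H : Hyp d F₀ F₁) {m : ℕ} {B : ℂ × ℂ} (h : Fx F₀ F₁ m B) (hB : B.1 ≠ 0) :
    ∀ᶠ w in nhds (B.2 / B.1), ((Fmap F₀ F₁)^[m] (1, w)).1 ≠ 0 :=
  (den_cont m).continuousAt.eventually_ne (H.den_ne h hB)

theorem hh_strict (H : Hyp d F₀ F₁) {m : ℕ} {B : ℂ × ℂ} (h : Fx F₀ F₁ m B) (hB : B.1 ≠ 0) :
    HasStrictDerivAt (hh F₀ F₁ m) (deriv (hh F₀ F₁ m) (B.2 / B.1)) (B.2 / B.1) := by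
  have e : hh F₀ F₁ m = fun w => (un (Fp F₀ F₁ m).2).eval w / (un (Fp F₀ F₁ m).1).eval w := by
    funext w; rw [un_eval, un_eval, Fp_ev1, Fp_ev2]; rfl
  have h1 := ((un (Fp F₀ F₁ m).2).hasStrictDerivAt (B.2 / B.1)).fun_div
    ((un (Fp F₀ F₁ m).1).hasStrictDerivAt (B.2 / B.1)) (by
      rw [un_eval, Fp_ev1]; exact H.den_ne h hB)
  rw [← e] at h1
  rw [h1.hasDerivAt.deriv]
  exact h1

theorem hh_comp (H : Hyp d F₀ F₁) (k m : ℕ) (w : ℂ) (hw : ((Fmap F₀ F₁)^[m] (1, w)).1 ≠ 0) :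
    hh F₀ F₁ (k + m) w = hh F₀ F₁ k (hh F₀ F₁ m w) := by
  have e : (Fmap F₀ F₁)^[m] (1, w) = ((Fmap F₀ F₁)^[m] (1, w)).1 • ((1 : ℂ), hh F₀ F₁ m w) := by
    ext
    · simp
    · simp [hh]; field_simp
  rw [hh, Function.iterate_add_apply, e, H.it_smul]
  simp only [Prod.smul_fst, Prod.smul_snd, smul_eq_mul]
  rw [mul_div_mul_left _ _ (pow_ne_zero _ hw)]
  rfl

theorem hh_iter (H : Hyp d F₀ F₁) {m : ℕ} {B : ℂ × ℂ} (h : Fx F₀ F₁ m B) (hB : B.1 ≠ 0) (b : ℕ) :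
    ∀ᶠ w in nhds (B.2 / B.1), hh F₀ F₁ (m * b) w = (hh F₀ F₁ m)^[b] w := by
  induction b with
  | zero => simp [hh]
  | succ b ih =>
    have hc : Tendsto (hh F₀ F₁ m) (nhds (B.2 / B.1)) (nhds (B.2 / B.1)) := by
      have := (H.hh_strict h hB).hasDerivAt.continuousAt
      rwa [ContinuousAt, H.hh_fix h hB] at this
    filter_upwards [H.den_ev h hB, hc.eventually ih] with w h1 h2
    rw [mul_add, mul_one, H.hh_comp _ _ _ h1, h2, Function.iterate_succ_apply]

theorem hh_deriv (H : Hyp d F₀ F₁) {m : ℕ} {B : ℂ × ℂ} (h : Fx F₀ F₁ m B) (hB : B.1 ≠ 0) (b : ℕ) :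
    deriv (hh F₀ F₁ (m * b)) (B.2 / B.1) = (deriv (hh F₀ F₁ m) (B.2 / B.1)) ^ b := by
  rw [Filter.EventuallyEq.deriv_eq (H.hh_iter h hB b)]
  exact (HasDerivAt.iterate _ (H.hh_strict h hB).hasDerivAt (H.hh_fix h hB) b).deriv

theorem Pp_one (m : ℕ) (w : ℂ) (hw : ((Fmap F₀ F₁)^[m] (1, w)).1 ≠ 0) :
    ev (Pp F₀ F₁ m) (1, w) = ((Fmap F₀ F₁)^[m] (1, w)).1 * (w - hh F₀ F₁ m w) := by
  rw [Pp_ev, wedge, hh]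
  field_simp

/-- simple multiplicity formula -/
theorem an1 (H : Hyp d F₀ F₁) {m e : ℕ} (hm : 1 ≤ m) {B : ℂ × ℂ} (h : Fx F₀ F₁ m B) (hB : B.1 ≠ 0)
    {Q : MvPolynomial (Fin 2) ℂ} (hQ : Q.IsHomogeneous e) (hP : Pp F₀ F₁ m = Q * Lf B) :
    ‖ev Q B‖ = ‖deriv (hh F₀ F₁ m) (B.2 / B.1) - 1‖ := by
  have hdeg := hom_deg (H.Pp_hom m) (H.Pp_ne hm) hQ (Lf_hom B) hP
  have he : e = d ^ m := by omega
  subst he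
  set z := B.2 / B.1 with hz
  set lm := deriv (hh F₀ F₁ m) z with hlm
  obtain ⟨s, hs, hs2, hs3⟩ := H.base h hB
  have h1 : ∀ᶠ w in nhds z, ((Fmap F₀ F₁)^[m] (1, w)).1 * (w - hh F₀ F₁ m w) = (un Q).eval w * (B.1 * (z - w)) := by
    filter_upwards [H.den_ev h hB] with w hw
    rw [← Pp_one m w hw, hP, ev_mul, ev_Lf, un_eval, wedge, hz]
    simp only; field_simp
  have dl : HasDerivAt (fun w => ((Fmap F₀ F₁)^[m] (1, w)).1 * (w - hh F₀ F₁ m w)) (s * (1 - lm)) z := by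
    have a1 : HasDerivAt (fun w : ℂ => ((Fmap F₀ F₁)^[m] (1, w)).1) ((un (Fp F₀ F₁ m).1).derivative.eval z) z := by
      have := (un (Fp F₀ F₁ m).1).hasDerivAt z
      have e0 : (fun w : ℂ => ((Fmap F₀ F₁)^[m] (1, w)).1) = fun w => (un (Fp F₀ F₁ m).1).eval w := by
        funext w; rw [un_eval, Fp_ev1]
      rw [e0]; exact this
    have := a1.mul ((hasDerivAt_id z).sub (H.hh_strict h hB).hasDerivAt)
    refine this.congr_deriv ?_
    simp only [Pi.sub_apply, id]
    rw [H.hh_fix h hB, hs3]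
    simp [hlm, ← hz]
  have dr : HasDerivAt (fun w => (un Q).eval w * (B.1 * (z - w))) (-((un Q).eval z * B.1)) z := by
    have := ((un Q).hasDerivAt z).mul (((hasDerivAt_const z z).sub (hasDerivAt_id z)).const_mul B.1)
    refine this.congr_deriv ?_
    simp
  have e1 : s * (1 - lm) = -((un Q).eval z * B.1) :=
    dl.unique (dr.congr_of_eventuallyEq h1)
  have e2 : B = B.1 • ((1 : ℂ), z) := by
    ext
    · simp
    · simp [hz]; field_simp
  have e3 : ev Q B = B.1 ^ (d ^ m) * (un Q).eval z := by
    rw [un_eval]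
    conv_lhs => rw [e2]
    rw [ev_hom hQ]
  have e4 := congrArg norm e1
  rw [norm_neg, norm_mul, norm_mul, norm_sub_rev] at e4
  rw [e3, norm_mul, norm_pow]
  have hn : ‖B.1‖ ≠ 0 := norm_ne_zero_iff.2 hB
  have hsn : ‖s‖ ≠ 0 := norm_ne_zero_iff.2 hs
  apply mul_left_cancel₀ (mul_ne_zero hsn hn)
  linear_combination ‖(un Q).eval z‖ * ‖B.1‖ * hs2 - ‖B.1‖ * e4

/-- quotient formula -/
theorem an2 (H : Hyp d F₀ F₁) {m b e : ℕ} (hm : 1 ≤ m) (hb : 1 ≤ b) {B : ℂ × ℂ} (h : Fx F₀ F₁ m B) (hB : B.1 ≠ 0)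
    {Q : MvPolynomial (Fin 2) ℂ} (hQ : Q.IsHomogeneous e) (hP : Pp F₀ F₁ (m * b) = Pp F₀ F₁ m * Q) :
    ‖ev Q B‖ = ‖∑ i ∈ range b, (deriv (hh F₀ F₁ m) (B.2 / B.1)) ^ i‖ := by
  have hmb : 1 ≤ m * b := Nat.mul_pos hm hb
  have hdeg := hom_deg (H.Pp_hom (m * b)) (H.Pp_ne hmb) (H.Pp_hom m) hQ hP
  have he : d ^ (m * b) = d ^ m + e := by omega
  set z := B.2 / B.1 with hz
  set lm := deriv (hh F₀ F₁ m) z with hlm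
  have hfb := H.fx_mul h b
  obtain ⟨s, hs, hs2, hs3⟩ := H.base h hB
  obtain ⟨t, ht, ht2, ht3⟩ := H.base hfb hB
  set g := hh F₀ F₁ m with hg
  set r : ℂ → ℂ := fun w => ((Fmap F₀ F₁)^[m] (1, w)).1 * (un Q).eval w / ((Fmap F₀ F₁)^[m * b] (1, w)).1 with hr
  have h1 : ∀ᶠ w in nhds z, g^[b] w - w = r w * (g w - w) := by
    filter_upwards [H.den_ev h hB, H.den_ev hfb hB, H.hh_iter h hB b] with w w1 w2 w3
    have a1 := Pp_one (m * b) w w2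
    have a2 := Pp_one m w w1
    rw [hP, ev_mul, a2, ← un_eval, w3] at a1
    simp only [hr]
    field_simp
    linear_combination a1
  have hst : HasStrictDerivAt (fun w => ∑ i ∈ range b, g^[i] w) (∑ i ∈ range b, lm ^ i) z :=
    HasStrictDerivAt.fun_sum (fun i _ => HasStrictDerivAt.iterate _ (H.hh_strict h hB) (H.hh_fix h hB) i)
  have hgc : Tendsto g (nhds z) (nhds z) := by
    have := (H.hh_strict h hB).hasDerivAt.continuousAt
    rwa [ContinuousAt, H.hh_fix h hB] at this
  have h2 : Tendsto (fun w => (g w, w)) (nhds z) (nhds (z, z)) := hgc.prodMk_nhds tendsto_id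
  have h3 := (hasStrictDerivAt_iff_hasStrictFDerivAt.1 hst).isLittleO.comp_tendsto h2
  have h4 : (fun w => (r w - ∑ i ∈ range b, lm ^ i) * (g w - w)) =o[nhds z] fun w => g w - w := by
    refine h3.congr' ?_ (by rfl)
    filter_upwards [h1] with w hw
    simp only [Function.comp]
    have tel : ∑ i ∈ range b, g^[i] (g w) - ∑ i ∈ range b, g^[i] w = g^[b] w - w := by
      rw [← Finset.sum_sub_distrib]
      have := Finset.sum_range_sub (fun i => g^[i] w) b
      simpa using this
    rw [tel, hw]
    simp
    ring
  have h5 : ∀ᶠ w in nhdsWithin z {z}ᶜ, g w - w ≠ 0 := by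
    have hu : un (Pp F₀ F₁ m) ≠ 0 := by
      intro h0
      apply H.Pp_ne hm
      apply hom_ext (H.Pp_hom m) (isHomogeneous_zero _ _ _)
      intro w
      rw [← un_eval, h0]; simp [ev]
    have fin : (↑((un (Pp F₀ F₁ m)).roots.toFinset) \ {z} : Set ℂ).Finite := (Finset.finite_toSet _).subset Set.sdiff_subset
    have : ∀ᶠ w in nhds z, w ∉ (↑((un (Pp F₀ F₁ m)).roots.toFinset) \ {z} : Set ℂ) :=
      fin.isClosed.isOpen_compl.mem_nhds (by simp)
    filter_upwards [this.filter_mono nhdsWithin_le_nhds, (H.den_ev h hB).filter_mono nhdsWithin_le_nhds, self_mem_nhdsWithin]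
      with w w1 w2 w3 w4
    apply w1
    refine ⟨?_, w3⟩
    simp only [Finset.mem_coe, Multiset.mem_toFinset]
    rw [Polynomial.mem_roots hu, Polynomial.IsRoot, un_eval, Pp_one m w w2]
    linear_combination -((Fmap F₀ F₁)^[m] (1, w)).1 * w4
  have h6 : Tendsto (fun w => r w - ∑ i ∈ range b, lm ^ i) (nhdsWithin z {z}ᶜ) (nhds 0) := by
    have := (h4.mono nhdsWithin_le_nhds).tendsto_div_nhds_zero (l := nhdsWithin z {z}ᶜ)
    refine this.congr' ?_
    filter_upwards [h5] with w hw
    field_simp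
  have h7 : ContinuousAt r z :=
    ((den_cont m).continuousAt.mul (Polynomial.continuous _).continuousAt).div (den_cont (m * b)).continuousAt (H.den_ne hfb hB)
  have h8 : Tendsto (fun w => r w - ∑ i ∈ range b, lm ^ i) (nhdsWithin z {z}ᶜ) (nhds (r z - ∑ i ∈ range b, lm ^ i)) :=
    (h7.tendsto.sub tendsto_const_nhds).mono_left nhdsWithin_le_nhds
  have h9 : r z = ∑ i ∈ range b, lm ^ i := by
    have := tendsto_nhds_unique h8 h6
    linear_combination this
  rw [← h9]
  have e2 : B = B.1 • ((1 : ℂ), z) := by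
    ext
    · simp
    · simp [hz]; field_simp
  have e3 : ev Q B = B.1 ^ e * (un Q).eval z := by
    rw [un_eval]
    conv_lhs => rw [e2]
    rw [ev_hom hQ]
  simp only [hr]
  rw [hs3, ht3, e3]
  simp only [Prod.smul_fst, smul_eq_mul, mul_one, norm_mul, norm_div, norm_pow]
  have hn : ‖B.1‖ ≠ 0 := norm_ne_zero_iff.2 hB
  have hsn : ‖s‖ ≠ 0 := norm_ne_zero_iff.2 hs
  have htn : ‖t‖ ≠ 0 := norm_ne_zero_iff.2 ht
  rw [eq_div_iff htn]
  rw [he, pow_add] at ht2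
  have : ‖t‖ * ‖B.1‖ ^ e = ‖s‖ := by
    apply mul_right_cancel₀ (pow_ne_zero (d ^ m) hn)
    linear_combination ht2 - hs2
  linear_combination ‖(un Q).eval z‖ * this

end Hyp


theorem cyc_sum (x : ℂ) {a b : ℕ} (ha : 1 ≤ a) (hb : 1 ≤ b) :
    ∏ e ∈ (a * b).divisors \ a.divisors, (Polynomial.cyclotomic e ℂ).eval x = ∑ i ∈ range b, (x ^ a) ^ i := by
  have hab : 0 < a * b := Nat.mul_pos ha hb
  have h1 : (∏ e ∈ (a * b).divisors \ a.divisors, Polynomial.cyclotomic e ℂ) * (Polynomial.X ^ a - 1) =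
      Polynomial.X ^ (a * b) - 1 := by
    rw [← Polynomial.prod_cyclotomic_eq_X_pow_sub_one ha, ← Polynomial.prod_cyclotomic_eq_X_pow_sub_one hab]
    exact Finset.prod_sdiff (Nat.divisors_subset_of_dvd (by omega) (dvd_mul_right _ _))
  have h2 : (∏ e ∈ (a * b).divisors \ a.divisors, Polynomial.cyclotomic e ℂ) =
      ∑ i ∈ range b, (Polynomial.X ^ a) ^ i := by
    have h0 : (Polynomial.X ^ a - 1 : Polynomial ℂ) ≠ 0 := Polynomial.X_pow_sub_C_ne_zero ha 1
    apply mul_right_cancel₀ h0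
    rw [h1, geom_sum_mul, pow_mul]
  rw [← Polynomial.eval_prod, h2]
  simp [Polynomial.eval_finsetSum]

theorem cyc_pure {N : ℕ} (hN : 1 ≤ N) (x : ℂ) (ψ : ℕ → ℝ)
    (h : ∀ a b, 1 ≤ a → 1 ≤ b → a * b ∣ N → ∏ e ∈ (a * b).divisors \ a.divisors, ψ e = ‖∑ i ∈ range b, (x ^ a) ^ i‖)
    (e : ℕ) : e ∣ N → 1 < e → ψ e = ‖(Polynomial.cyclotomic e ℂ).eval x‖ := by
  induction e using Nat.strong_induction_on with
  | _ e ih =>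
  intro heN he
  have : ∃ a, a ∣ e ∧ a < e ∧ 1 ≤ a ∧ ∀ c, c ∣ e → c < e → ¬ c ∣ a → (Polynomial.cyclotomic c ℂ).eval x ≠ 0 := by
    by_cases hex : ∃ a, a ∣ e ∧ a < e ∧ (Polynomial.cyclotomic a ℂ).eval x = 0
    · obtain ⟨a, h1, h2, h3⟩ := hex
      have ha : 1 ≤ a := Nat.pos_of_dvd_of_pos h1 (by omega)
      refine ⟨a, h1, h2, ha, fun c hc hce hca h0 => hca ?_⟩
      have hc1 : 1 ≤ c := Nat.pos_of_dvd_of_pos hc (by omega)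
      have : NeZero (a : ℂ) := ⟨by exact_mod_cast (by omega : a ≠ 0)⟩
      have : NeZero (c : ℂ) := ⟨by exact_mod_cast (by omega : c ≠ 0)⟩
      have p1 : IsPrimitiveRoot x a := Polynomial.isRoot_cyclotomic_iff.1 h3
      have p2 : IsPrimitiveRoot x c := Polynomial.isRoot_cyclotomic_iff.1 h0
      rw [p1.unique p2]
    · push Not at hex
      exact ⟨1, one_dvd _, he, le_rfl, fun c hc hce _ => hex c hc hce⟩
  obtain ⟨a, hae, halt, ha, hne⟩ := this
  obtain ⟨b, rfl⟩ := hae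
  have hb : 1 ≤ b := by
    rcases Nat.eq_zero_or_pos b with rfl | hb
    · simp at he
    · exact hb
  have h1 := h a b ha hb heN
  rw [← cyc_sum x ha hb, norm_prod] at h1
  have hmem : a * b ∈ (a * b).divisors \ a.divisors := by
    rw [Finset.mem_sdiff, Nat.mem_divisors, Nat.mem_divisors]
    refine ⟨⟨dvd_rfl, by omega⟩, fun h2 => ?_⟩
    have := Nat.le_of_dvd ha h2.1
    omega
  rw [← Finset.mul_prod_erase _ _ hmem, ← Finset.mul_prod_erase _ _ hmem] at h1
  have key : ∀ c ∈ ((a * b).divisors \ a.divisors).erase (a * b), c ∣ a * b ∧ c < a * b ∧ ¬ c ∣ a ∧ 1 < c := by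
    intro c hc
    rw [Finset.mem_erase, Finset.mem_sdiff, Nat.mem_divisors, Nat.mem_divisors] at hc
    obtain ⟨q1, ⟨q2, q3⟩, q4⟩ := hc
    have q5 : ¬ c ∣ a := fun q => q4 ⟨q, by omega⟩
    have q6 : 1 ≤ c := Nat.pos_of_dvd_of_pos q2 (by omega)
    have q7 : c ≠ 1 := by rintro rfl; exact q5 (one_dvd _)
    exact ⟨q2, lt_of_le_of_ne (Nat.le_of_dvd (by omega) q2) q1, q5, by omega⟩
  rw [Finset.prod_congr rfl (fun c hc => ih c (key c hc).2.1 ((key c hc).1.trans heN) (key c hc).2.2.2)] at h1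
  refine mul_right_cancel₀ ?_ h1
  rw [Finset.prod_ne_zero_iff]
  intro c hc
  obtain ⟨k1, k2, k3, k4⟩ := key c hc
  exact norm_ne_zero_iff.2 (hne c k1 k2 k3)

namespace Dat
variable {d n : ℕ} {F₀ F₁ : MvPolynomial (Fin 2) ℂ} {dm : ℕ → ℕ} {Z : ℕ → ℕ → ℂ × ℂ}

theorem Ph_hom (k : ℕ) : (Ph dm Z k).IsHomogeneous (dm k) := by
  have := IsHomogeneous.prod (range (dm k)) (fun j => Lf (Z k j)) (fun _ => 1) (fun j _ => Lf_hom _)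
  simpa [Ph] using this

theorem Phprod_hom (D : Finset ℕ) : (∏ k ∈ D, Ph dm Z k).IsHomogeneous (∑ k ∈ D, dm k) :=
  IsHomogeneous.prod D _ _ (fun k _ => Ph_hom k)

theorem Ph_zero {k j : ℕ} (hj : j < dm k) : ev (Ph dm Z k) (Z k j) = 0 := by
  rw [Ph, ev_prod]
  apply Finset.prod_eq_zero (mem_range.2 hj)
  rw [ev_Lf, wedge_self]

theorem fx (h : Dat d F₀ F₁ n dm Z) {l j : ℕ} (hl : l ∣ n) (hj : j < dm l) : Fx F₀ F₁ l (Z l j) := by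
  apply h.H.nz_fix (h.nz l hl j hj) (h.pos hl)
  rw [h.dyn l hl, ev_prod]
  apply Finset.prod_eq_zero (i := l) _ (Ph_zero hj)
  rw [Nat.mem_divisors]
  have := h.pos hl
  exact ⟨dvd_rfl, by omega⟩

theorem cyc1 (h : Dat d F₀ F₁ n dm Z) (hf : ∀ m, m ∣ n → ∀ j < dm m, (Z m j).1 ≠ 0) {l j : ℕ} (hl : l ∣ n)
    (hj : j < dm l) {e : ℕ} (he : e ∣ n / l) (he1 : 1 < e) :
    ∏ k ∈ n.divisors with k.lcm l = l * e, ‖ev (Ph dm Z k) (Z l j)‖ =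
      ‖(Polynomial.cyclotomic e ℂ).eval (deriv (hh F₀ F₁ l) ((Z l j).2 / (Z l j).1))‖ := by
  have hn := h.hn
  have hl1 := h.pos hl
  obtain ⟨N, rfl⟩ := hl
  rw [Nat.mul_div_cancel_left _ hl1] at he
  have hN : 1 ≤ N := Nat.pos_of_ne_zero (by rintro rfl; simp at hn)
  refine cyc_pure hN _ (fun e => ∏ k ∈ (l * N).divisors with k.lcm l = l * e, ‖ev (Ph dm Z k) (Z l j)‖) ?_ e he he1
  intro a b ha hb hab
  have hla : 1 ≤ l * a := Nat.mul_pos hl1 ha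
  have hlab : l * a * b ∣ l * N := by rw [mul_assoc]; exact mul_dvd_mul_left _ hab
  have hfx := h.H.fx_mul (h.fx (dvd_mul_right l N) hj) a
  have hB := hf l (dvd_mul_right l N) j hj
  have e1 := h.H.an2 hla hb hfx hB (Phprod_hom _) (h.dyn_quot hlab (dvd_mul_right (l * a) b))
  rw [h.H.hh_deriv (h.fx (dvd_mul_right l N) hj) hB] at e1
  rw [← e1, ev_prod, norm_prod]
  have hdv : ∀ k c, k ∣ l * c ↔ k.lcm l / l ∣ c := by
    intro k c
    obtain ⟨x, hx⟩ := Nat.dvd_lcm_right k l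
    rw [hx, Nat.mul_div_cancel_left _ hl1]
    constructor
    · intro hk
      have := Nat.lcm_dvd hk (dvd_mul_right l c)
      rw [hx] at this
      exact Nat.dvd_of_mul_dvd_mul_left hl1 this
    · intro hk
      exact (Nat.dvd_lcm_left k l).trans (hx ▸ mul_dvd_mul_left l hk)
  have hab0 : a * b ≠ 0 := (Nat.mul_pos ha hb).ne'
  have hlab0 : l * a * b ≠ 0 := (Nat.mul_pos hla hb).ne'
  have hmaps : ∀ k ∈ (l * a * b).divisors \ (l * a).divisors, k.lcm l / l ∈ (a * b).divisors \ a.divisors := by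
    intro k hk
    rw [Finset.mem_sdiff, Nat.mem_divisors, Nat.mem_divisors] at hk ⊢
    obtain ⟨⟨k1, -⟩, k2⟩ := hk
    refine ⟨⟨(hdv _ _).1 (by rwa [← mul_assoc]), hab0⟩, fun k3 => k2 ⟨(hdv _ _).2 k3.1, by omega⟩⟩
  rw [← Finset.prod_fiberwise_of_maps_to hmaps]
  apply Finset.prod_congr rfl
  intro e' he'
  rw [Finset.mem_sdiff, Nat.mem_divisors, Nat.mem_divisors] at he'
  obtain ⟨⟨k1, -⟩, k2⟩ := he'
  apply Finset.prod_congr _ (fun _ _ => rfl)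
  ext k
  rw [Finset.mem_filter, Finset.mem_filter, Finset.mem_sdiff, Nat.mem_divisors, Nat.mem_divisors, Nat.mem_divisors]
  have heq : k.lcm l = l * e' ↔ k.lcm l / l = e' := by
    obtain ⟨x, hx⟩ := Nat.dvd_lcm_right k l
    rw [hx, Nat.mul_div_cancel_left _ hl1]
    constructor
    · intro q; exact Nat.eq_of_mul_eq_mul_left hl1 q
    · rintro rfl; rfl
  rw [heq, mul_assoc l a b, hdv k N, hdv k (a * b), hdv k a]
  constructor
  · rintro ⟨q1, rfl⟩
    refine ⟨⟨⟨k1, by rwa [mul_assoc] at hlab0⟩, fun q => k2 ⟨q.1, by omega⟩⟩, rfl⟩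
  · rintro ⟨q1, rfl⟩
    exact ⟨⟨k1.trans hab, by omega⟩, rfl⟩

theorem cyc2 (h : Dat d F₀ F₁ n dm Z) (hf : ∀ m, m ∣ n → ∀ j < dm m, (Z m j).1 ≠ 0) {l : ℕ} (hl : l ∣ n) (hln : l < n) :
    Mv dm Z l (Ph dm Z n) =
      ∏ j ∈ range (dm l), ‖(Polynomial.cyclotomic (n / l) ℂ).eval (deriv (hh F₀ F₁ l) ((Z l j).2 / (Z l j).1))‖ := by
  have hl1 := h.pos hl
  have hn := h.hn
  have hnl : l * (n / l) = n := Nat.mul_div_cancel' hl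
  have he1 : 1 < n / l := by
    rw [Nat.lt_div_iff_mul_lt' hl]; omega
  rw [Finset.prod_congr rfl (fun j hj => (h.cyc1 hf hl (mem_range.1 hj) dvd_rfl he1).symm), Finset.prod_comm, hnl]
  have hmem : n ∈ n.divisors.filter (fun k => k.lcm l = n) := by
    rw [Finset.mem_filter, Nat.mem_divisors]
    exact ⟨⟨dvd_rfl, by omega⟩, Nat.lcm_eq_left hl⟩
  have e1 : ∏ k ∈ (n.divisors.filter (fun k => k.lcm l = n)).erase n, Mv dm Z l (Ph dm Z k) = 1 := by
    apply Finset.prod_eq_one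
    intro k hk
    rw [Finset.mem_erase, Finset.mem_filter, Nat.mem_divisors] at hk
    obtain ⟨k1, ⟨k2, -⟩, k3⟩ := hk
    refine h.one hl k k2 ?_ ?_
    · intro q; rw [Nat.lcm_eq_left q] at k3; exact k1 k3
    · intro q; rw [Nat.lcm_eq_right q] at k3; omega
  rw [← Finset.mul_prod_erase _ _ hmem]
  exact ((congrArg (Mv dm Z l (Ph dm Z n) * ·) e1).trans (mul_one _)).symm

end Dat


theorem prod_range_blocks (f : ℕ → ℝ) (n q : ℕ) :
    ∏ j ∈ range (n * q), f j = ∏ r ∈ range q, ∏ k ∈ range n, f (n * r + k) := by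
  induction q with
  | zero => simp
  | succ q ih => rw [mul_add, mul_one, Finset.prod_range_add, ih, Finset.prod_range_succ]

theorem shift_prod (f : ℕ → ℝ) {n k : ℕ} (hk : k < n) :
    ∏ t ∈ Ico 1 n, f ((k + t) % n) = ∏ m ∈ (range n).erase k, f m := by
  have hm : ∀ x, x < 2 * n → x % n = if x < n then x else x - n := by
    intro x hx
    split_ifs with h
    · exact Nat.mod_eq_of_lt h
    · rw [Nat.mod_eq_sub_mod (by omega), Nat.mod_eq_of_lt (by omega)]
  refine Finset.prod_bij' (fun t _ => (k + t) % n) (fun m _ => (m + (n - k)) % n) ?_ ?_ ?_ ?_ ?_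
  · intro t ht
    simp only [mem_Ico, mem_erase, mem_range] at ht ⊢
    rw [hm _ (by omega)]
    split_ifs <;> omega
  · intro t ht
    simp only [mem_Ico, mem_erase, mem_range] at ht ⊢
    rw [hm _ (by omega)]
    split_ifs <;> omega
  · intro t ht
    simp only [mem_Ico] at ht ⊢
    rw [hm (k + t) (by omega)]
    split_ifs
    · rw [hm _ (by omega)]; split_ifs <;> omega
    · rw [hm _ (by omega)]; split_ifs <;> omega
  · intro t ht
    simp only [mem_erase, mem_range] at ht ⊢
    rw [hm (t + (n - k)) (by omega)]
    split_ifs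
    · rw [hm _ (by omega)]; split_ifs <;> omega
    · rw [hm _ (by omega)]; split_ifs <;> omega
  · intro t _; rfl

theorem erase_prod_ite {s : Finset ℕ} {j : ℕ} (hj : j ∈ s) (f : ℕ → ℝ) :
    ∏ i ∈ s.erase j, f i = ∏ i ∈ s, if i = j then 1 else f i := by
  rw [← Finset.mul_prod_erase s _ hj]
  simp only [if_true, one_mul]
  apply Finset.prod_congr rfl
  intro i hi
  rw [if_neg (Finset.ne_of_mem_erase hi)]

theorem split_prod (w : ℕ → ℕ → ℝ) (n q : ℕ) :
    ∏ j ∈ range (n * q), ∏ i ∈ (range (n * q)).erase j, w j i =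
      (∏ r ∈ range q, ∏ k ∈ range n, ∏ m ∈ (range n).erase k, w (n * r + k) (n * r + m)) *
      ∏ r ∈ range q, ∏ s ∈ (range q).erase r, ∏ k ∈ range n, ∏ m ∈ range n, w (n * r + k) (n * s + m) := by
  rw [Finset.prod_congr rfl (fun j hj => erase_prod_ite hj (w j)), prod_range_blocks]
  rw [← Finset.prod_mul_distrib]
  apply Finset.prod_congr rfl
  intro r hr
  have e1 : ∏ k ∈ range n, ∏ i ∈ range (n * q), (if i = n * r + k then 1 else w (n * r + k) i) =
      ∏ s ∈ range q, ∏ k ∈ range n, ∏ m ∈ range n, (if n * s + m = n * r + k then 1 else w (n * r + k) (n * s + m)) := by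
    rw [Finset.prod_congr rfl (fun k _ => prod_range_blocks (fun i => if i = n * r + k then 1 else w (n * r + k) i) n q),
      Finset.prod_comm]
  rw [e1, ← Finset.mul_prod_erase _ _ hr]
  congr 1
  · apply Finset.prod_congr rfl
    intro k hk
    rw [erase_prod_ite hk]
    apply Finset.prod_congr rfl
    intro m _
    simp
  · apply Finset.prod_congr rfl
    intro s hs
    apply Finset.prod_congr rfl
    intro k hk
    apply Finset.prod_congr rfl
    intro m hm
    rw [if_neg]
    intro he
    rw [mem_range] at hk hm
    apply Finset.ne_of_mem_erase hs
    have h1 : (n * s + m) / n = s := by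
      rw [Nat.mul_add_div (by omega), Nat.div_eq_of_lt hm, add_zero]
    have h2 : (n * r + k) / n = r := by
      rw [Nat.mul_add_div (by omega), Nat.div_eq_of_lt hk, add_zero]
    rw [← h1, he, h2]

namespace Dat
variable {d n : ℕ} {F₀ F₁ : MvPolynomial (Fin 2) ℂ} {dm : ℕ → ℕ} {Z : ℕ → ℕ → ℂ × ℂ}

theorem step1 (h : Dat d F₀ F₁ n dm Z) (hf : ∀ m, m ∣ n → ∀ j < dm m, (Z m j).1 ≠ 0) :
    ∏ j ∈ range (dm n), ‖deriv (hh F₀ F₁ n) ((Z n j).2 / (Z n j).1) - 1‖ =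
      (∏ j ∈ range (dm n), ∏ i ∈ (range (dm n)).erase j, ‖wedge (Z n j) (Z n i)‖) *
        ∏ l ∈ n.properDivisors, Mv dm Z n (Ph dm Z l) := by
  have hn := h.hn
  have e : ∀ j ∈ range (dm n), ‖deriv (hh F₀ F₁ n) ((Z n j).2 / (Z n j).1) - 1‖ =
      (∏ i ∈ (range (dm n)).erase j, ‖wedge (Z n j) (Z n i)‖) * ‖ev (∏ l ∈ n.properDivisors, Ph dm Z l) (Z n j)‖ := by
    intro j hj
    have hj' := mem_range.1 hj
    have hP : Pp F₀ F₁ n = ((∏ i ∈ (range (dm n)).erase j, Lf (Z n i)) * ∏ l ∈ n.properDivisors, Ph dm Z l) * Lf (Z n j) := by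
      rw [h.dyn n dvd_rfl, ← Nat.cons_self_properDivisors (by omega), Finset.prod_cons, Ph, ← Finset.mul_prod_erase _ _ hj]
      ring
    have hQ := (IsHomogeneous.prod ((range (dm n)).erase j) (fun i => Lf (Z n i)) (fun _ => 1) (fun j _ => Lf_hom _)).mul
      (Phprod_hom (dm := dm) (Z := Z) n.properDivisors)
    rw [← h.H.an1 hn (h.fx dvd_rfl hj') (hf n dvd_rfl j hj') hQ hP, ev_mul, norm_mul, ev_prod, norm_prod]
    simp only [ev_Lf]
  rw [Finset.prod_congr rfl e, Finset.prod_mul_distrib, ← Mv_prod]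
  rfl

theorem step4 (h : Dat d F₀ F₁ n dm Z) :
    ∏ t ∈ Ico 1 n, Mv dm Z n (Pp F₀ F₁ t) = ∏ l ∈ n.properDivisors, Mv dm Z n (Ph dm Z l) ^ (n / l - 1) := by
  have hn := h.hn
  have e : ∀ t ∈ Ico 1 n, Mv dm Z n (Pp F₀ F₁ t) = ∏ l ∈ n.properDivisors, if l ∣ t then Mv dm Z n (Ph dm Z l) else 1 := by
    intro t ht
    rw [mem_Ico] at ht
    have hg : 1 ≤ t.gcd n := Nat.gcd_pos_of_pos_left _ ht.1
    obtain ⟨Q, _, hQ, -, -⟩ := h.H.quot hg ht.1 (Nat.gcd_dvd_left t n)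
    have h1 := h.one2 n dvd_rfl t ht.1 (Nat.not_dvd_of_pos_of_lt ht.1 ht.2) Q hQ
    rw [hQ, Mv_mul, h1, mul_one, h.dyn _ (Nat.gcd_dvd_right t n), Mv_prod, ← Finset.prod_filter]
    apply Finset.prod_congr _ (fun _ _ => rfl)
    ext l
    rw [Finset.mem_filter, Nat.mem_divisors, Nat.mem_properDivisors, Nat.dvd_gcd_iff]
    constructor
    · rintro ⟨⟨q1, q2⟩, -⟩
      exact ⟨⟨q2, lt_of_le_of_lt (Nat.le_of_dvd ht.1 q1) ht.2⟩, q1⟩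
    · rintro ⟨⟨q1, q2⟩, q3⟩
      exact ⟨⟨q3, q1⟩, by omega⟩
  rw [Finset.prod_congr rfl e, Finset.prod_comm]
  apply Finset.prod_congr rfl
  intro l hl
  rw [Nat.mem_properDivisors] at hl
  rw [← Finset.prod_filter, Finset.prod_const]
  congr 1
  have h1 := Nat.Ioc_filter_dvd_card_eq_div n l
  have h2 : (Ioc 0 n).filter (fun x => l ∣ x) = insert n ((Ico 1 n).filter (fun x => l ∣ x)) := by
    ext x
    simp only [mem_filter, mem_insert, mem_Ioc, mem_Ico]
    constructor
    · rintro ⟨q1, q2⟩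
      rcases eq_or_ne x n with q | q
      · exact Or.inl q
      · exact Or.inr ⟨⟨by omega, by omega⟩, q2⟩
    · rintro (rfl | ⟨q1, q2⟩)
      · exact ⟨⟨by omega, le_rfl⟩, hl.1⟩
      · exact ⟨⟨by omega, by omega⟩, q2⟩
  rw [h2, Finset.card_insert_of_notMem (by simp)] at h1
  omega

theorem step3 (h : Dat d F₀ F₁ n dm Z) {q : ℕ} (hq : dm n = n * q)
    (hcyc : ∀ r < q, ∀ k < n, ∃ c : ℂ, ‖c‖ = 1 ∧ Fmap F₀ F₁ (Z n (n * r + k)) = c • Z n (n * r + (k + 1) % n)) :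
    ∏ r ∈ range q, ∏ k ∈ range n, ∏ m ∈ (range n).erase k, ‖wedge (Z n (n * r + k)) (Z n (n * r + m))‖ =
      ∏ t ∈ Ico 1 n, Mv dm Z n (Pp F₀ F₁ t) := by
  have it : ∀ r < q, ∀ k < n, ∀ t, ∃ c : ℂ, ‖c‖ = 1 ∧
      (Fmap F₀ F₁)^[t] (Z n (n * r + k)) = c • Z n (n * r + (k + t) % n) := by
    intro r hr k hk t
    induction t with
    | zero => exact ⟨1, by simp, by simp [Nat.mod_eq_of_lt hk]⟩
    | succ t ih =>
      obtain ⟨c, hc, h1⟩ := ih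
      obtain ⟨c', hc', h2⟩ := hcyc r hr ((k + t) % n) (Nat.mod_lt _ h.hn)
      refine ⟨c ^ d * c', by simp [hc, hc'], ?_⟩
      rw [Function.iterate_succ_apply', h1, h.H.F_smul, h2, smul_smul]
      congr 3
      rw [Nat.mod_add_mod, add_assoc]
  have e : ∀ t ∈ Ico 1 n, Mv dm Z n (Pp F₀ F₁ t) =
      ∏ r ∈ range q, ∏ k ∈ range n, ‖wedge (Z n (n * r + k)) (Z n (n * r + (k + t) % n))‖ := by
    intro t _
    rw [Mv, hq, prod_range_blocks]
    apply Finset.prod_congr rfl; intro r hr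
    apply Finset.prod_congr rfl; intro k hk
    obtain ⟨c, hc, h1⟩ := it r (mem_range.1 hr) k (mem_range.1 hk) t
    rw [Pp_ev, h1, wedge_smul_left, norm_mul, hc, one_mul, norm_wedge_comm]
  rw [Finset.prod_congr rfl e]
  symm
  rw [Finset.prod_comm]
  apply Finset.prod_congr rfl; intro r hr
  rw [Finset.prod_comm]
  apply Finset.prod_congr rfl; intro k hk
  exact shift_prod (fun m => ‖wedge (Z n (n * r + k)) (Z n (n * r + m))‖) (mem_range.1 hk)

theorem final (h : Dat d F₀ F₁ n dm Z) (hf : ∀ m, m ∣ n → ∀ j < dm m, (Z m j).1 ≠ 0) {q : ℕ} (hq : dm n = n * q)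
    (hcyc : ∀ r < q, ∀ k < n, ∃ c : ℂ, ‖c‖ = 1 ∧ Fmap F₀ F₁ (Z n (n * r + k)) = c • Z n (n * r + (k + 1) % n)) :
    ∏ j ∈ range (dm n), ‖deriv (hh F₀ F₁ n) ((Z n j).2 / (Z n j).1) - 1‖ =
      (∏ l ∈ n.properDivisors,
        (∏ j ∈ range (dm l),
          ‖(Polynomial.cyclotomic (n / l) ℂ).eval (deriv (hh F₀ F₁ l) ((Z l j).2 / (Z l j).1))‖) ^ (n / l)) *
      ∏ r ∈ range q, ∏ s ∈ (range q).erase r, ∏ k ∈ range n, ∏ m ∈ range n,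
        ‖wedge (Z n (n * r + k)) (Z n (n * s + m))‖ := by
  rw [h.step1 hf]
  conv_lhs => rw [hq, split_prod (fun j i => ‖wedge (Z n j) (Z n i)‖), h.step3 hq hcyc, h.step4]
  rw [mul_right_comm, ← Finset.prod_mul_distrib]
  congr 1
  apply Finset.prod_congr rfl
  intro l hl
  rw [Nat.mem_properDivisors] at hl
  rw [← h.cyc2 hf hl.1 hl.2, Mv_swap, ← pow_succ]
  congr 1
  have : 1 ≤ n / l := Nat.div_pos hl.2.le (h.pos hl.1)
  omega

end Dat

theorem pair_prod (y : ℕ → ℝ) (hy : ∀ r, y r ≠ 0) (q : ℕ) (h : ∏ r ∈ range q, y r = 1) :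
    ∏ r ∈ range q, ∏ s ∈ (range q).erase r, (y r * y s) = 1 := by
  have e : ∀ r ∈ range q, ∏ s ∈ (range q).erase r, (y r * y s) = y r ^ (q - 1) * (y r)⁻¹ := by
    intro r hr
    rw [Finset.prod_mul_distrib, Finset.prod_const, Finset.card_erase_of_mem hr, card_range]
    congr 1
    rw [← Finset.mul_prod_erase _ _ hr] at h
    exact eq_inv_of_mul_eq_one_right h
  rw [Finset.prod_congr rfl e, Finset.prod_mul_distrib, Finset.prod_pow, h, Finset.prod_inv_distrib, h]
  simp

theorem normalize_data {d n : ℕ} {F₀ F₁ : MvPolynomial (Fin 2) ℂ} (H : Hyp d F₀ F₁) (hn : 1 ≤ n) (dm : ℕ → ℕ)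
    (Zp : ℕ → ℕ → ℂ × ℂ) (hfst : ∀ m, m ∣ n → ∀ j < dm m, (Zp m j).1 ≠ 0)
    (hdyn : ∀ m, m ∣ n → Pp F₀ F₁ m = ∏ k ∈ m.divisors, Ph dm Zp k) :
    ∃ (ν : ℕ → ℕ → ℝ) (Z : ℕ → ℕ → ℂ × ℂ), (∀ m j, 0 < ν m j) ∧ (∀ m j, Zp m j = (ν m j : ℂ) • Z m j) ∧
      (∏ j ∈ range (dm n), ν n j = 1) ∧ Dat d F₀ F₁ n dm Z := by
  have hpos : ∀ m, m ∣ n → 1 ≤ m := fun m hm => Nat.pos_of_dvd_of_pos hm hn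
  have ex : ∀ m j, ∃ (ν : ℝ) (B : ℂ × ℂ), 0 < ν ∧ Zp m j = (ν : ℂ) • B ∧ (m ∣ n → j < dm m → Nz F₀ F₁ B) := by
    intro m j
    by_cases hm : m ∣ n ∧ j < dm m
    · have h1 : ev (Pp F₀ F₁ m) (Zp m j) = 0 := by
        rw [hdyn m hm.1, ev_prod]
        apply Finset.prod_eq_zero (i := m) _ (Dat.Ph_zero hm.2)
        rw [Nat.mem_divisors]
        have := hpos m hm.1
        exact ⟨dvd_rfl, by omega⟩
      have h2 : Zp m j ≠ 0 := by
        intro h0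
        apply hfst m hm.1 j hm.2
        rw [h0]; rfl
      obtain ⟨ν, hν, B, hB, e⟩ := H.nz_exists h2 (hpos m hm.1) h1
      exact ⟨ν, B, hν, e, fun _ _ => hB⟩
    · exact ⟨1, Zp m j, one_pos, by simp, fun a b => absurd ⟨a, b⟩ hm⟩
  choose ν Z hν hZ hNz using ex
  have hPh : ∀ k, Ph dm Zp k = C ((∏ j ∈ range (dm k), ν k j : ℝ) : ℂ) * Ph dm Z k := by
    intro k
    apply ev_funext; intro W
    rw [ev_mul, ev_C]
    simp only [Ph, ev_prod, ev_Lf]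
    rw [Complex.ofReal_prod, ← Finset.prod_mul_distrib]
    apply Finset.prod_congr rfl; intro j _
    rw [hZ k j, wedge_smul_right]
  have hx : ∀ k, 0 < ∏ j ∈ range (dm k), ν k j := fun k => Finset.prod_pos (fun j _ => hν k j)
  have h1 : ∀ m, m ∣ n → ∏ k ∈ m.divisors, ∏ j ∈ range (dm k), ν k j = 1 := by
    intro m hm
    refine H.norm_one (hpos m hm) (S := Tm dm Z m.divisors) (Finset.prod_pos (fun k _ => hx k)) ?_ ?_
    · intro W
      rw [hdyn m hm, ← Tm_af, ev_prod, ev_prod, norm_prod, norm_prod, ← Finset.prod_mul_distrib]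
      apply Finset.prod_congr rfl; intro k _
      rw [hPh, ev_mul, ev_C, norm_mul, Complex.norm_real, Real.norm_of_nonneg (hx k).le]
    · intro B hB
      obtain ⟨a, ha, j, hj, rfl⟩ := Tm_mem hB
      exact hNz a j ((Nat.dvd_of_mem_divisors ha).trans hm) hj
  have h2 : ∀ m, m ∣ n → ∏ j ∈ range (dm m), ν m j = 1 := by
    intro m
    induction m using Nat.strong_induction_on with
    | _ m ih =>
    intro hm
    have e := h1 m hm
    have hm1 := hpos m hm
    rw [← Nat.cons_self_properDivisors (by omega), Finset.prod_cons] at e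
    have e2 : ∏ k ∈ m.properDivisors, ∏ j ∈ range (dm k), ν k j = 1 := by
      apply Finset.prod_eq_one
      intro k hk
      rw [Nat.mem_properDivisors] at hk
      exact ih k hk.2 (hk.1.trans hm)
    rwa [e2, mul_one] at e
  refine ⟨ν, Z, hν, hZ, h2 n dvd_rfl, H, hn, fun m hm j hj => hNz m j hm hj, fun m hm => ?_⟩
  rw [hdyn m hm]
  apply Finset.prod_congr rfl
  intro k hk
  rw [hPh, h2 k ((Nat.dvd_of_mem_divisors hk).trans hm)]
  simp

/-- Assume `|Res F| = 1`, fix dynatomic data for `n`, assume `n ∣ d_n`,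
and assume the points of formally exact period `n` are labeled along cycles of
`f : w ↦ F₁(1,w)/F₀(1,w)` (0-based labeling: `f(z^{(n)}_{nr+k}) = z^{(n)}_{nr+k+1}` for
`0 ≤ k ≤ n−2`, and `f(z^{(n)}_{nr+n−1}) = z^{(n)}_{nr}`).  Then
`∏_j |λ^{(n)}_j − 1| = ∏_{ℓ ∣ n, ℓ < n} (∏_j |C_{n/ℓ}(λ^{(ℓ)}_j)|)^{n/ℓ}
  · ∏_{r ≠ s} ∏_{k,m < n} |Z^{(n)}_{nr+k} ∧ Z^{(n)}_{ns+m}|`. -/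
theorem stmt15 (d : ℕ) (hd : 2 ≤ d) (F₀ F₁ : MvPolynomial (Fin 2) ℂ)
    (h₀ : F₀.IsHomogeneous d) (h₁ : F₁.IsHomogeneous d)
    (hcz : ∀ Z : ℂ × ℂ, ev F₀ Z = 0 → ev F₁ Z = 0 → Z = 0)
    (A : Fin d → ℂ × ℂ) (hA : ∀ i, A i ≠ 0)
    (hfac : ∀ Z : ℂ × ℂ, ev F₀ Z = ∏ i, wedge Z (A i))
    (hres : ∏ i, ‖ev F₁ (A i)‖ = 1)
    (n : ℕ) (hn : 1 ≤ n)
    (Zp : ℕ → ℕ → ℂ × ℂ)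
    (hfst : ∀ m ∈ n.divisors, ∀ j ∈ Finset.range (dyndeg d m).toNat, (Zp m j).1 ≠ 0)
    (hdyn : ∀ m ∈ n.divisors, ∀ Z : ℂ × ℂ,
      wedge ((Fmap F₀ F₁)^[m] Z) Z =
        ∏ k ∈ m.divisors, ∏ j ∈ Finset.range (dyndeg d k).toNat, wedge Z (Zp k j))
    (hden : ∀ m ∈ n.divisors, ∀ j ∈ Finset.range (dyndeg d m).toNat,
      ((Fmap F₀ F₁)^[m] (1, zc Zp m j)).1 ≠ 0)
    (hdvd : n ∣ (dyndeg d n).toNat)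
    (hF₀z : ∀ j ∈ Finset.range (dyndeg d n).toNat, ev F₀ (1, zc Zp n j) ≠ 0)
    (hcyc : ∀ r < (dyndeg d n).toNat / n, ∀ k < n - 1,
      ev F₁ (1, zc Zp n (n * r + k)) / ev F₀ (1, zc Zp n (n * r + k)) =
        zc Zp n (n * r + k + 1))
    (hcyc' : ∀ r < (dyndeg d n).toNat / n,
      ev F₁ (1, zc Zp n (n * r + (n - 1))) / ev F₀ (1, zc Zp n (n * r + (n - 1))) =
        zc Zp n (n * r)) :
    ∏ j ∈ Finset.range (dyndeg d n).toNat, ‖lam F₀ F₁ Zp n j - 1‖ =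
      (∏ ℓ ∈ n.properDivisors,
          (∏ j ∈ Finset.range (dyndeg d ℓ).toNat,
            ‖Polynomial.eval (lam F₀ F₁ Zp ℓ j) (Polynomial.cyclotomic (n / ℓ) ℂ)‖) ^ (n / ℓ)) *
        ∏ r ∈ Finset.range ((dyndeg d n).toNat / n),
          ∏ s ∈ (Finset.range ((dyndeg d n).toNat / n)).erase r,
            ∏ k ∈ Finset.range n, ∏ m ∈ Finset.range n,
              ‖wedge (Zp n (n * r + k)) (Zp n (n * s + m))‖ := by
  have H : Hyp d F₀ F₁ := by
    refine ⟨hd, h₀, h₁, hcz, (Finset.univ : Finset (Fin d)).val.map A, by simp, fun Z => ?_, ?_⟩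
    · rw [hfac Z, Multiset.map_map]; rfl
    · rw [Multiset.map_map]; exact hres
  have hn0 : n ≠ 0 := by omega
  set dm : ℕ → ℕ := fun m => (dyndeg d m).toNat with hdm
  have hmem : ∀ m, m ∣ n → m ∈ n.divisors := fun m hm => Nat.mem_divisors.2 ⟨hm, hn0⟩
  have hfst' : ∀ m, m ∣ n → ∀ j < dm m, (Zp m j).1 ≠ 0 :=
    fun m hm j hj => hfst m (hmem m hm) j (mem_range.2 hj)
  have hdyn' : ∀ m, m ∣ n → Pp F₀ F₁ m = ∏ k ∈ m.divisors, Ph dm Zp k := by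
    intro m hm
    apply ev_funext; intro W
    rw [Pp_ev, hdyn m (hmem m hm), ev_prod]
    simp only [Ph, ev_prod, ev_Lf, hdm]
  obtain ⟨ν, Z, hν, hZ, hν1, D⟩ := normalize_data H hn dm Zp hfst' hdyn'
  have hνc : ∀ m j, (ν m j : ℂ) ≠ 0 := fun m j => Complex.ofReal_ne_zero.2 (hν m j).ne'
  have hzc : ∀ m j, zc Zp m j = (Z m j).2 / (Z m j).1 := by
    intro m j
    rw [zc, hZ m j]
    simp only [Prod.smul_fst, Prod.smul_snd, smul_eq_mul]
    rw [mul_div_mul_left _ _ (hνc m j)]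
  have hlam : ∀ m j, lam F₀ F₁ Zp m j = deriv (hh F₀ F₁ m) ((Z m j).2 / (Z m j).1) := by
    intro m j
    rw [← hzc]; rfl
  have hf : ∀ m, m ∣ n → ∀ j < dm m, (Z m j).1 ≠ 0 := by
    intro m hm j hj h0
    apply hfst' m hm j hj
    rw [hZ m j]; simp [h0]
  obtain ⟨q, hq⟩ := hdvd
  have hqd : (dyndeg d n).toNat / n = q := by rw [hq, Nat.mul_div_cancel_left _ hn]
  rw [hqd] at hcyc hcyc' ⊢
  have hlt : ∀ r < q, ∀ k < n, n * r + k < dm n := by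
    intro r hr k hk
    have : n * (r + 1) ≤ n * q := Nat.mul_le_mul_left _ hr
    rw [mul_add, mul_one] at this
    change _ < (dyndeg d n).toNat
    omega
  have hC : ∀ r < q, ∀ k < n, ∃ c : ℂ, ‖c‖ = 1 ∧ Fmap F₀ F₁ (Z n (n * r + k)) = c • Z n (n * r + (k + 1) % n) := by
    intro r hr k hk
    have hj := hlt r hr k hk
    have hj' := hlt r hr ((k + 1) % n) (Nat.mod_lt _ hn)
    have hnext : ev F₁ (1, zc Zp n (n * r + k)) / ev F₀ (1, zc Zp n (n * r + k)) =
        zc Zp n (n * r + (k + 1) % n) := by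
      rcases Nat.lt_or_ge k (n - 1) with hk1 | hk1
      · rw [hcyc r hr k hk1, Nat.mod_eq_of_lt (by omega), add_assoc]
      · have : k = n - 1 := by omega
        subst this
        rw [hcyc' r hr, Nat.sub_add_cancel hn, Nat.mod_self, add_zero]
    have h0 := hF₀z _ (mem_range.2 hj)
    set j := n * r + k
    set j' := n * r + (k + 1) % n
    have pt : ∀ i < dm n, Z n i = (Z n i).1 • ((1 : ℂ), zc Zp n i) := by
      intro i hi
      have := hf n dvd_rfl i hi
      rw [hzc]
      ext
      · simp
      · simp; field_simp
    have e1 : Fmap F₀ F₁ ((1 : ℂ), zc Zp n j) = ev F₀ (1, zc Zp n j) • ((1 : ℂ), zc Zp n j') := by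
      rw [← hnext]
      ext
      · simp [Fmap]
      · simp [Fmap]; field_simp
    have hf' := hf n dvd_rfl j' hj'
    have e2 : Fmap F₀ F₁ (Z n j) = ((Z n j).1 ^ d * ev F₀ (1, zc Zp n j) * ((Z n j').1)⁻¹) • Z n j' := by
      have e0 : ((1 : ℂ), zc Zp n j') = ((Z n j').1)⁻¹ • Z n j' := by
        rw [hzc]
        ext
        · simp [hf']
        · simp; field_simp
      conv_lhs => rw [pt j hj, H.F_smul, e1, e0]
      rw [smul_smul, smul_smul]
    refine ⟨_, ?_, e2⟩
    apply H.nz_smul (D.nz n dvd_rfl j' hj')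
    rw [← e2]
    exact H.nz_F (D.nz n dvd_rfl j hj)
  have key := D.final hf hq hC
  simp only [hlam]
  refine key.trans ?_
  congr 1
  have hb : ∏ r ∈ range q, (∏ k ∈ range n, ν n (n * r + k)) ^ n = 1 := by
    rw [Finset.prod_pow, ← prod_range_blocks (ν n), ← hq]
    rw [show ∏ j ∈ range (dyndeg d n).toNat, ν n j = 1 from hν1, one_pow]
  have hb2 := pair_prod (fun r => (∏ k ∈ range n, ν n (n * r + k)) ^ n)
    (fun r => pow_ne_zero _ (Finset.prod_ne_zero_iff.2 (fun k _ => (hν n _).ne'))) q hb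
  rw [← one_mul (∏ r ∈ range q, _), ← hb2, ← Finset.prod_mul_distrib]
  apply Finset.prod_congr rfl; intro r _
  rw [← Finset.prod_mul_distrib]
  apply Finset.prod_congr rfl; intro s _
  have e3 : ∀ k ∈ range n, ∏ m ∈ range n, ‖wedge (Zp n (n * r + k)) (Zp n (n * s + m))‖ =
      ν n (n * r + k) ^ n * (∏ m ∈ range n, ν n (n * s + m)) *
        ∏ m ∈ range n, ‖wedge (Z n (n * r + k)) (Z n (n * s + m))‖ := by
    intro k _
    have : ∀ m ∈ range n, ‖wedge (Zp n (n * r + k)) (Zp n (n * s + m))‖ =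
        ν n (n * r + k) * ν n (n * s + m) * ‖wedge (Z n (n * r + k)) (Z n (n * s + m))‖ := by
      intro m _
      rw [hZ n (n * r + k), hZ n (n * s + m), wedge_smul_left, wedge_smul_right, norm_mul, norm_mul,
        Complex.norm_real, Complex.norm_real, Real.norm_of_nonneg (hν _ _).le, Real.norm_of_nonneg (hν _ _).le]
      ring
    rw [Finset.prod_congr rfl this, Finset.prod_mul_distrib, Finset.prod_mul_distrib, Finset.prod_const, card_range]
  rw [Finset.prod_congr rfl e3, Finset.prod_mul_distrib, Finset.prod_mul_distrib, Finset.prod_const, card_range,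
    Finset.prod_pow]
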